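/- arXiv:1005.3836 — 3 statements merged into one kernel-verified Lean document; each statement's English description precedes it below -/
import Mathlib

section
/- For all integers p, q ≥ 3 with (p−2)(q−2) > 4 (the condition for {p,q} to be a regular tessellation of the hyperbolic plane), there exists a locally finite face-to-face tiling of ℝ² by convex polygons each having exactly p extreme points, such that every point of ℝ² which is an extreme point of some tile is an extreme point of exactly q tiles; that is, every regular hyperbolic tessellation {p,q} can be realized by a (non-normal) tiling of the Euclidean plane by convex p-gons with q meeting at each vertex. -/
open Set

noncomputable section

abbrev Euc (d : ℕ) := EuclideanSpace ℝ (Fin d)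

/-- A tiling of `ℝ^d`: a family of closed sets covering the space with pairwise
disjoint interiors. -/
def IsTiling {d : ℕ} (𝒯 : Set (Set (Euc d))) : Prop :=
  (∀ T ∈ 𝒯, IsClosed T) ∧ ⋃₀ 𝒯 = Set.univ ∧
    𝒯.Pairwise fun S T => interior S ∩ interior T = ∅

/-- Local finiteness: every compact set meets only finitely many tiles. -/
def LocallyFiniteTiling {d : ℕ} (𝒯 : Set (Set (Euc d))) : Prop :=
  ∀ K : Set (Euc d), IsCompact K → {T ∈ 𝒯 | (T ∩ K).Nonempty}.Finite

/-- `S` is an isometric copy of `T`. -/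
def IsometricCopy {d : ℕ} (S T : Set (Euc d)) : Prop :=
  ∃ g : Euc d ≃ᵢ Euc d, g '' T = S

/-- A monohedral tiling with prototile `T`. -/
def Monohedral {d : ℕ} (𝒯 : Set (Set (Euc d))) (T : Set (Euc d)) : Prop :=
  ∀ S ∈ 𝒯, IsometricCopy S T

/-- A convex `d`-polytope in `ℝ^d`: convex hull of a finite set, with nonempty interior. -/
def IsConvexPolytope {d : ℕ} (P : Set (Euc d)) : Prop :=
  (∃ V : Finset (Euc d), P = convexHull ℝ (V : Set (Euc d))) ∧ (interior P).Nonempty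

/-- A tiling is face-to-face if the intersection of any two distinct tiles is a
face (extreme subset), possibly empty, of each of them. -/
def FaceToFace {d : ℕ} (𝒯 : Set (Set (Euc d))) : Prop :=
  ∀ S ∈ 𝒯, ∀ T ∈ 𝒯, S ≠ T → IsExtreme ℝ S (S ∩ T) ∧ IsExtreme ℝ T (S ∩ T)

/-- Combinatorial equivalence: an order isomorphism between the face posets
(posets of extreme subsets ordered by inclusion). -/
def CombEquiv {d e : ℕ} (P : Set (Euc d)) (Q : Set (Euc e)) : Prop :=
  Nonempty ({F : Set (Euc d) // IsExtreme ℝ P F} ≃o {F : Set (Euc e) // IsExtreme ℝ Q F})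

/-- A facet: a maximal proper nonempty face. -/
def IsFacet {d : ℕ} (Q F : Set (Euc d)) : Prop :=
  IsExtreme ℝ Q F ∧ F.Nonempty ∧ F ≠ Q ∧
    ∀ G : Set (Euc d), IsExtreme ℝ Q G → G ≠ Q → F ⊆ G → G = F

/-- Unit vectors of a real vector space with a symmetric bilinear form. -/
structure UnitRoots (S V : Type*) [AddCommGroup V] [Module ℝ V] where
  form : LinearMap.BilinForm ℝ V
  root : S → V
  symm : ∀ u v, form u v = form v u
  unit : ∀ s, form (root s) (root s) = 1

namespace UnitRoots

variable {S V : Type*} [AddCommGroup V] [Module ℝ V] (R : UnitRoots S V)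

/-- The reflection in the hyperplane orthogonal to a root. -/
def refl (s : S) : V ≃ₗ[ℝ] V :=
  Module.reflection (x := R.root s) (f := (2 : ℝ) • R.form (R.root s)) (by simp [R.unit s])

lemma refl_apply (s : S) (v : V) :
    R.refl s v = v - (2 * R.form v (R.root s)) • R.root s := by
  rw [refl, Module.reflection_apply, R.symm v]
  simp

lemma refl_root (s : S) : R.refl s (R.root s) = -R.root s := by
  rw [refl_apply, R.unit]; module

lemma refl_mul_self (s : S) : R.refl s * R.refl s = 1 := by
  ext v
  exact Module.involutive_reflection _ v

lemma refl_refl (s : S) (v : V) : R.refl s (R.refl s v) = v :=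
  LinearEquiv.congr_fun (R.refl_mul_self s) v

lemma refl_eq_self {s : S} {v : V} (h : R.form v (R.root s) = 0) : R.refl s v = v := by
  simp [refl_apply, h]

lemma form_refl (s : S) (u v : V) : R.form (R.refl s u) (R.refl s v) = R.form u v := by
  simp only [refl_apply, map_sub, map_smul, LinearMap.sub_apply, LinearMap.smul_apply, smul_eq_mul,
    R.unit, R.symm (R.root s) v]
  ring

lemma form_refl_left (s : S) (u v : V) : R.form (R.refl s u) v = R.form u (R.refl s v) := by
  rw [← R.form_refl s, refl_refl]

/-- `R.IsWord I n g` says that `g` is a product of `n` reflections with labels in `I`. -/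
inductive IsWord (I : Set S) : ℕ → (V ≃ₗ[ℝ] V) → Prop
  | one : IsWord I 0 1
  | mul_refl {n g s} : IsWord I n g → s ∈ I → IsWord I (n + 1) (g * R.refl s)

variable {R}

namespace IsWord

variable {I J : Set S} {m n : ℕ} {g h : V ≃ₗ[ℝ] V}

lemma refl {s : S} (hs : s ∈ I) : R.IsWord I 1 (R.refl s) := by
  simpa using (one (R := R) (I := I)).mul_refl hs

lemma mul (hg : R.IsWord I m g) (hh : R.IsWord I n h) : R.IsWord I (m + n) (g * h) := by
  induction hh with
  | one => simpa using hg
  | mul_refl _ hs ih => simpa [mul_assoc, add_assoc] using ih.mul_refl hs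

lemma mono (hg : R.IsWord I n g) (hIJ : I ⊆ J) : R.IsWord J n g := by
  induction hg with
  | one => exact one
  | mul_refl _ hs ih => exact ih.mul_refl (hIJ hs)

lemma exists_inv (hg : R.IsWord I n g) : R.IsWord I n g⁻¹ := by
  induction hg with
  | one => simpa using one
  | @mul_refl n g s _ hs ih =>
    have h : (g * R.refl s)⁻¹ = R.refl s * g⁻¹ := by
      rw [mul_inv_rev, inv_eq_of_mul_eq_one_left (R.refl_mul_self s)]
    rw [h, add_comm]
    exact (refl hs).mul ih

lemma form_apply (hg : R.IsWord I n g) (u v : V) : R.form (g u) (g v) = R.form u v := by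
  induction hg generalizing u v with
  | one => rfl
  | mul_refl _ _ ih => simp only [LinearEquiv.mul_apply, ih, R.form_refl]

lemma form_inv_left (hg : R.IsWord I n g) (u v : V) : R.form (g⁻¹ u) v = R.form u (g v) := by
  rw [← hg.form_apply, ← LinearEquiv.mul_apply, mul_inv_cancel, LinearEquiv.coe_one, id]

lemma apply_eq_self (hg : R.IsWord I n g) {v : V} (hv : ∀ s ∈ I, R.form v (R.root s) = 0) :
    g v = v := by
  induction hg with
  | one => rfl
  | mul_refl _ hs ih => rw [LinearEquiv.mul_apply, R.refl_eq_self (hv _ hs), ih]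

end IsWord

variable (R)

/-- The alternating product of `k` reflections with labels `s` and `t`, ending with `t`. -/
def alt : S → S → ℕ → (V ≃ₗ[ℝ] V)
  | _, _, 0 => 1
  | s, t, k + 1 => alt t s k * R.refl t

lemma alt_succ (s t : S) (k : ℕ) : R.alt s t (k + 1) = R.alt t s k * R.refl t := by
  rw [alt]

lemma alt_succ_mul_refl (s t : S) (k : ℕ) : R.alt s t (k + 1) * R.refl t = R.alt t s k := by
  rw [alt_succ, mul_assoc, R.refl_mul_self, mul_one]

lemma alt_succ' (s t : S) (k : ℕ) :
    R.alt s t (k + 1) = R.refl (if Even k then t else s) * R.alt s t k := by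
  induction k generalizing s t with
  | zero => simp [alt]
  | succ k ih =>
    rw [alt_succ, ih, mul_assoc, ← alt_succ]
    by_cases h : Even k <;> simp [h, Nat.even_add_one]

lemma isWord_alt {I : Set S} {s t : S} (hs : s ∈ I) (ht : t ∈ I) (k : ℕ) :
    R.IsWord I k (R.alt s t k) := by
  induction k generalizing s t with
  | zero => exact .one
  | succ k ih => exact (ih ht hs).mul_refl ht

lemma exists_alt_of_isWord {s t : S} {n : ℕ} {g : V ≃ₗ[ℝ] V} (hg : R.IsWord {s, t} n g) :
    ∃ j ≤ n, g = R.alt s t j ∨ g = R.alt t s j := by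
  have key (s t : S) (j n : ℕ) (hj : j ≤ n) : ∃ i ≤ n + 1,
      R.alt s t j * R.refl t = R.alt s t i ∨ R.alt s t j * R.refl t = R.alt t s i := by
    cases j with
    | zero => exact ⟨1, by omega, .inl (by simp [alt])⟩
    | succ j => exact ⟨j, by omega, .inr (by rw [alt_succ_mul_refl])⟩
  induction hg with
  | one => exact ⟨0, le_rfl, .inl rfl⟩
  | @mul_refl n g r _ hr ih =>
    obtain ⟨j, hj, h⟩ := ih
    rcases hr with rfl | rfl <;> rcases h with rfl | rfl
    · exact ⟨j + 1, by omega, .inr (by rw [alt_succ])⟩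
    · simpa [or_comm] using key _ _ j n hj
    · simpa [or_comm] using key _ _ j n hj
    · exact ⟨j + 1, by omega, .inl (by rw [alt_succ])⟩

lemma sin_smul_alt_root {s t : S} {θ : ℝ} (h : R.form (R.root s) (R.root t) = -Real.cos θ)
    (k : ℕ) : Real.sin θ • R.alt s t k (R.root s) =
      Real.sin ((k + 1) * θ) • R.root (if Even k then s else t) +
        Real.sin (k * θ) • R.root (if Even k then t else s) := by
  induction k with
  | zero => simp [alt]
  | succ k ih =>
    have e : Real.sin ((k + 1 + 1) * θ) =
        2 * Real.cos θ * Real.sin ((k + 1) * θ) - Real.sin (k * θ) := by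
      rw [show (k + 1 + 1) * θ = (k + 1) * θ + θ by ring,
        show k * θ = (k + 1) * θ - θ by ring, Real.sin_add, Real.sin_sub]
      ring
    rw [alt_succ', LinearEquiv.mul_apply, ← map_smul, ih]
    by_cases hk : Even k <;>
      simp only [hk, if_true, if_false, Nat.even_add_one, not_true, not_false_iff, map_add,
        map_smul, R.unit, R.refl_apply _ (R.root _), h, R.symm (R.root t), Nat.cast_add,
        Nat.cast_one, e] <;> module

variable {R}

lemma alt_eq_alt {s t : S} {m : ℕ} (hm : 2 ≤ m)
    (h : R.form (R.root s) (R.root t) = -Real.cos (Real.pi / m)) :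
    R.alt s t m = R.alt t s m := by
  set θ := Real.pi / m with hθ
  have hm0 : (m : ℝ) ≠ 0 := by positivity
  have hθm : m * θ = Real.pi := by rw [hθ]; field_simp
  have hs : 0 < Real.sin θ := Real.sin_pos_of_pos_of_lt_pi (by positivity)
    (div_lt_self Real.pi_pos (by exact_mod_cast hm))
  have hroot {s t : S} (h : R.form (R.root s) (R.root t) = -Real.cos θ) :
      R.alt s t m (R.root s) = R.alt t s m (R.root s) := by
    obtain ⟨k, rfl⟩ : ∃ k, m = k + 1 := ⟨m - 1, by omega⟩
    rw [R.alt_succ t s, LinearEquiv.mul_apply, R.refl_root, map_neg]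
    apply smul_right_injective V hs.ne'
    simp only [smul_neg]
    rw [R.sin_smul_alt_root h, R.sin_smul_alt_root h]
    have e1 : Real.sin ((k + 1) * θ) = 0 := by
      rw [← Real.sin_pi, ← hθm]; push_cast; rfl
    have e2 : Real.sin ((k + 1 + 1) * θ) = - Real.sin θ := by
      rw [← Real.sin_add_pi, ← hθm]; push_cast; ring_nf
    have e3 : Real.sin (k * θ) = Real.sin θ := by
      rw [← Real.sin_pi_sub, ← hθm]; push_cast; ring_nf
    by_cases hk : Even k <;> simp [hk, e1, e2, e3, Nat.even_add_one]
  have h' : R.form (R.root t) (R.root s) = -Real.cos θ := by rw [R.symm, h]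
  ext v
  set c := Real.cos θ
  have hd : 1 - c ^ 2 ≠ 0 := by rw [← Real.sin_sq]; positivity
  set x := R.form v (R.root s)
  set y := R.form v (R.root t)
  obtain ⟨a, b, hab1, hab2⟩ : ∃ a b : ℝ, a - c * b = x ∧ b - c * a = y :=
    ⟨(x + c * y) / (1 - c ^ 2), (y + c * x) / (1 - c ^ 2), by field_simp; ring, by
      field_simp; ring⟩
  obtain ⟨w, hw⟩ : ∃ w, v = w + (a • R.root s + b • R.root t) := ⟨_, (sub_add_cancel _ _).symm⟩
  have hw1 : R.form w (R.root s) = 0 := by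
    have : R.form v (R.root s) = x := rfl
    rw [hw] at this
    simp only [map_add, map_smul, LinearMap.add_apply, LinearMap.smul_apply, smul_eq_mul, R.unit,
      h'] at this
    linarith
  have hw2 : R.form w (R.root t) = 0 := by
    have : R.form v (R.root t) = y := rfl
    rw [hw] at this
    simp only [map_add, map_smul, LinearMap.add_apply, LinearMap.smul_apply, smul_eq_mul, R.unit,
      h] at this
    linarith
  have hw3 : ∀ r ∈ ({s, t} : Set S), R.form w (R.root r) = 0 := by
    rintro r (rfl | rfl) <;> assumption
  rw [hw]
  simp only [map_add, map_smul]
  rw [(R.isWord_alt (by simp) (by simp) m).apply_eq_self hw3,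
    (R.isWord_alt (by simp) (by simp) m).apply_eq_self hw3, hroot h, hroot h']

variable (R)

/-- The roots form a basis of simple roots of a Coxeter group without infinite labels. -/
def IsCoxeter : Prop :=
  ∀ s t, s ≠ t → ∃ m : ℕ, 2 ≤ m ∧ R.form (R.root s) (R.root t) = -Real.cos (Real.pi / m)

/-- The closed fundamental chamber. -/
def chamber : Set V := {v | ∀ s, 0 ≤ R.form v (R.root s)}

/-- A vector is positive if it pairs nonnegatively with the fundamental chamber. -/
def IsPos (u : V) : Prop := ∀ v ∈ R.chamber, 0 ≤ R.form v u

variable {R}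

lemma IsPos.add {u v : V} (hu : R.IsPos u) (hv : R.IsPos v) : R.IsPos (u + v) := fun w hw ↦ by
  rw [map_add]; exact add_nonneg (hu w hw) (hv w hw)

lemma IsPos.smul {u : V} (hu : R.IsPos u) {a : ℝ} (ha : 0 ≤ a) : R.IsPos (a • u) := fun w hw ↦ by
  rw [map_smul]; exact mul_nonneg ha (hu w hw)

lemma isPos_root (s : S) : R.IsPos (R.root s) := fun _ hv ↦ hv s

lemma exists_isWord_alt_mul_refl {s t : S} {m : ℕ} (hm : 2 ≤ m)
    (h : R.form (R.root s) (R.root t) = -Real.cos (Real.pi / m)) {j : ℕ} (hj : m ≤ j) :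
    ∃ i < j, R.IsWord {s, t} i (R.alt s t j * R.refl s) := by
  induction j, hj using Nat.le_induction with
  | base =>
    obtain ⟨k, rfl⟩ : ∃ k, m = k + 1 := ⟨m - 1, by omega⟩
    refine ⟨k, by omega, ?_⟩
    rw [alt_eq_alt hm h, alt_succ_mul_refl]
    exact R.isWord_alt (by simp) (by simp) k
  | succ j _ ih =>
    obtain ⟨i, hi, hw⟩ := ih
    refine ⟨1 + i, by omega, ?_⟩
    rw [alt_succ', mul_assoc]
    exact (IsWord.refl (by split_ifs <;> simp)).mul hw

lemma exists_dihedral_root_eq {s t : S} {m : ℕ} (hm : 2 ≤ m)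
    (h : R.form (R.root s) (R.root t) = -Real.cos (Real.pi / m)) {n : ℕ} {g : V ≃ₗ[ℝ] V}
    (hg : R.IsWord {s, t} n g) (hmin : ∀ i < n, ¬ R.IsWord {s, t} i (g * R.refl s)) :
    ∃ a b : ℝ, 0 ≤ a ∧ 0 ≤ b ∧ g (R.root s) = a • R.root s + b • R.root t := by
  have key (j : ℕ) (hj : j ≤ n) (hgj : g = R.alt s t j) :
      ∃ a b : ℝ, 0 ≤ a ∧ 0 ≤ b ∧ g (R.root s) = a • R.root s + b • R.root t := by
    subst hgj
    have hjm : j < m := by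
      by_contra! hmj
      obtain ⟨i, hi, hw⟩ := exists_isWord_alt_mul_refl hm h hmj
      exact hmin i (by omega) hw
    set θ := Real.pi / m with hθ
    have hθm : m * θ = Real.pi := by rw [hθ]; field_simp
    have hθ0 : 0 < θ := by positivity
    have hs : 0 < Real.sin θ := Real.sin_pos_of_pos_of_lt_pi hθ0
      (div_lt_self Real.pi_pos (by exact_mod_cast hm))
    have hjm' : (j : ℝ) + 1 ≤ m := by exact_mod_cast hjm
    have h1 : 0 ≤ Real.sin ((j + 1) * θ) :=
      Real.sin_nonneg_of_nonneg_of_le_pi (by positivity) (by nlinarith)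
    have h2 : 0 ≤ Real.sin (j * θ) :=
      Real.sin_nonneg_of_nonneg_of_le_pi (by positivity) (by nlinarith)
    have e := R.sin_smul_alt_root h j
    have e' : R.alt s t j (R.root s) = (Real.sin θ)⁻¹ • (Real.sin ((j + 1) * θ) •
        R.root (if Even j then s else t) + Real.sin (j * θ) • R.root (if Even j then t else s)) := by
      rw [← e, inv_smul_smul₀ hs.ne']
    by_cases hj : Even j
    · refine ⟨(Real.sin θ)⁻¹ * Real.sin ((j + 1) * θ), (Real.sin θ)⁻¹ * Real.sin (j * θ),
        by positivity, by positivity, ?_⟩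
      rw [e']; simp only [hj, if_true]; module
    · refine ⟨(Real.sin θ)⁻¹ * Real.sin (j * θ), (Real.sin θ)⁻¹ * Real.sin ((j + 1) * θ),
        by positivity, by positivity, ?_⟩
      rw [e']; simp only [hj, if_false]; module
  obtain ⟨j, hj, hgj | hgj⟩ := R.exists_alt_of_isWord hg
  · exact key j hj hgj
  · cases j with
    | zero => exact key 0 hj hgj
    | succ j =>
      refine absurd ?_ (hmin j (by omega))
      rw [hgj, alt_succ_mul_refl]
      exact R.isWord_alt (by simp) (by simp) j

/-- If right multiplication by a simple reflection does not shorten `g`, then `g` maps the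
corresponding simple root to a positive vector. -/
theorem isPos_apply_root (hR : R.IsCoxeter) {n : ℕ} {g : V ≃ₗ[ℝ] V} {s : S}
    (hg : R.IsWord univ n g) (hmin : ∀ i < n, ¬ R.IsWord univ i (g * R.refl s)) :
    R.IsPos (g (R.root s)) := by
  induction n using Nat.strong_induction_on generalizing g s with
  | h n ih =>
  cases hg with
  | one => exact isPos_root s
  | @mul_refl n g t hg _ =>
    by_cases hst : s = t
    · subst hst
      refine absurd ?_ (hmin n (by omega))
      rwa [mul_assoc, R.refl_mul_self, mul_one]
    obtain ⟨m, hm, hform⟩ := hR s t hst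
    have hex : ∃ k l u x, k + l ≤ n + 1 ∧ R.IsWord univ k u ∧ R.IsWord {s, t} l x ∧
        g * R.refl t = u * x :=
      ⟨n, 1, g, R.refl t, le_rfl, hg, .refl (by simp), rfl⟩
    classical
    obtain ⟨l, u, x, hkl, hu, hx, hux⟩ := Nat.find_spec hex
    have hkmin := fun i (hi : i < Nat.find hex) ↦ Nat.find_min hex hi
    have hkn : Nat.find hex ≤ n := Nat.find_min' hex
      ⟨1, g, R.refl t, le_rfl, hg, .refl (by simp), rfl⟩
    set k := Nat.find hex
    have hpos (r : S) (hr : r ∈ ({s, t} : Set S)) : R.IsPos (u (R.root r)) := by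
      refine ih k (by omega) hu fun i hi hw ↦ hkmin i hi
        ⟨1 + l, u * R.refl r, R.refl r * x, by omega, hw, (IsWord.refl hr).mul hx, ?_⟩
      rw [hux, mul_assoc, ← mul_assoc (R.refl r), R.refl_mul_self, one_mul]
    obtain ⟨a, b, ha, hb, hab⟩ := exists_dihedral_root_eq hm hform hx fun i hi hw ↦ by
      refine hmin (k + i) (by omega) ?_
      rw [hux, mul_assoc]
      exact hu.mul (hw.mono (subset_univ _))
    rw [hux, LinearEquiv.mul_apply, hab, map_add, map_smul, map_smul]
    exact ((hpos s (by simp)).smul ha).add ((hpos t (by simp)).smul hb)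

lemma isPos_sub_apply (hR : R.IsCoxeter) {c : V} (hc : c ∈ R.chamber) {n : ℕ} {g : V ≃ₗ[ℝ] V}
    (hg : R.IsWord univ n g) : R.IsPos (c - g c) := by
  induction n using Nat.strong_induction_on generalizing g with
  | h n ih =>
  by_cases hex : ∃ i < n, R.IsWord univ i g
  · obtain ⟨i, hi, hw⟩ := hex
    exact ih i hi hw
  · push Not at hex
    cases hg with
    | one => intro v hv; simp
    | @mul_refl n g s hg _ =>
      have h := isPos_apply_root hR hg fun i hi ↦ hex i (by omega)
      have e : c - (g * R.refl s) c = (c - g c) + (2 * R.form c (R.root s)) • g (R.root s) := by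
        rw [LinearEquiv.mul_apply, R.refl_apply, map_sub, map_smul]; abel
      rw [e]
      exact (ih n (by omega) hg).add (h.smul (by linarith [hc s]))

lemma isPos_sub_refl_mul_apply (hR : R.IsCoxeter) {c : V} (hc : c ∈ R.chamber) {n : ℕ}
    {g : V ≃ₗ[ℝ] V} {s : S} (hg : R.IsWord univ n g)
    (hmin : ∀ i < n + 1, ¬ R.IsWord univ i (R.refl s * g)) :
    R.IsPos (c - (R.refl s * g) c - (2 * R.form c (R.root s)) • R.root s) := by
  induction hg with
  | one => intro v hv; simp [R.refl_apply]
  | @mul_refl n g t hg _ ih =>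
    have hsg : R.IsWord univ (n + 1) (R.refl s * g) := by
      rw [add_comm]; exact (IsWord.refl (mem_univ s)).mul hg
    have h := isPos_apply_root hR (s := t) hsg fun i hi hw ↦ by
      refine hmin i (by omega) ?_
      rwa [← mul_assoc]
    have ih' := ih fun i hi hw ↦ hmin (i + 1) (by omega) (by
      rw [← mul_assoc]; exact hw.mul_refl (mem_univ t))
    have e : c - (R.refl s * (g * R.refl t)) c - (2 * R.form c (R.root s)) • R.root s =
        (c - (R.refl s * g) c - (2 * R.form c (R.root s)) • R.root s) +
          (2 * R.form c (R.root t)) • (R.refl s * g) (R.root t) := by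
      rw [← mul_assoc, LinearEquiv.mul_apply _ (R.refl t), R.refl_apply t, map_sub, map_smul]
      abel
    rw [e]
    exact ih'.add (h.smul (by linarith [hc t]))

lemma exists_isWord_of_apply_eq_self (hR : R.IsCoxeter) {x : V} (hx : x ∈ R.chamber) {n : ℕ}
    {g : V ≃ₗ[ℝ] V} (hg : R.IsWord univ n g) (hgx : g x = x) :
    ∃ k, R.IsWord {s | R.form x (R.root s) = 0} k g := by
  induction n using Nat.strong_induction_on generalizing g with
  | h n ih =>
  by_cases hex : ∃ i < n, R.IsWord univ i g
  · obtain ⟨i, hi, hw⟩ := hex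
    exact ih i hi hw hgx
  · push Not at hex
    cases hg with
    | one => exact ⟨0, .one⟩
    | @mul_refl n g s hg _ =>
      have h := isPos_apply_root hR hg (fun i hi ↦ hex i (by omega)) x hx
      have h1 : R.form x (g (R.root s)) = -R.form x (R.root s) := by
        have := (hg.mul_refl (mem_univ s)).form_apply x (R.root s)
        rw [hgx, LinearEquiv.mul_apply, R.refl_root, map_neg, map_neg] at this
        linarith
      have h2 : R.form x (R.root s) = 0 := le_antisymm (by linarith) (hx s)
      have h3 : g x = x := by
        rwa [LinearEquiv.mul_apply, R.refl_eq_self h2] at hgx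
      obtain ⟨k, hk⟩ := ih n (by omega) hg h3
      exact ⟨k + 1, hk.mul_refl h2⟩

variable (R) in
/-- The group generated by the reflections with labels in `I`. -/
def parabolic (I : Set S) : Subgroup (V ≃ₗ[ℝ] V) where
  carrier := {g | ∃ n, R.IsWord I n g}
  one_mem' := ⟨0, .one⟩
  mul_mem' := fun ⟨_, h⟩ ⟨_, h'⟩ ↦ ⟨_, h.mul h'⟩
  inv_mem' := fun ⟨_, h⟩ ↦ ⟨_, h.exists_inv⟩

lemma refl_mem_parabolic {I : Set S} {s : S} (hs : s ∈ I) : R.refl s ∈ R.parabolic I :=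
  ⟨1, .refl hs⟩

lemma parabolic_mono {I J : Set S} (h : I ⊆ J) : R.parabolic I ≤ R.parabolic J :=
  fun _ ⟨n, hn⟩ ↦ ⟨n, hn.mono h⟩

lemma alt_eq_mul_pow (s t : S) (k : ℕ) :
    R.alt s t k = R.alt t s k * (R.refl s * R.refl t) ^ k := by
  have hs := R.refl_mul_self s
  have ht := R.refl_mul_self t
  have key (k : ℕ) : (R.refl s * R.refl t) ^ k * R.refl s * (R.refl s * R.refl t) ^ k =
      R.refl s := by
    induction k with
    | zero => simp
    | succ k ih =>
      calc _ = (R.refl s * R.refl t) ^ k * (R.refl s * R.refl t) * R.refl s *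
            (R.refl s * R.refl t * (R.refl s * R.refl t) ^ k) := by rw [← pow_succ, ← pow_succ']
        _ = (R.refl s * R.refl t) ^ k * R.refl s * (R.refl s * R.refl t) ^ k := by
            simp only [mul_assoc, ← mul_assoc (R.refl s) (R.refl s),
              ← mul_assoc (R.refl t) (R.refl t), hs, ht, one_mul]
        _ = _ := ih
  induction k with
  | zero => simp [alt]
  | succ k ih =>
    calc R.alt s t (k + 1) = R.alt t s k * R.refl t := by rw [alt_succ]
      _ = R.alt t s k * (R.refl s * (R.refl s * R.refl t)) := by
          rw [← mul_assoc (R.refl s), hs, one_mul]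
      _ = R.alt t s k * (((R.refl s * R.refl t) ^ k * R.refl s * (R.refl s * R.refl t) ^ k) *
            (R.refl s * R.refl t)) := by rw [key]
      _ = _ := by rw [R.alt_succ t s, ih, pow_succ]; simp only [mul_assoc]

lemma mul_pow_eq_one {s t : S} {m : ℕ} (hm : 2 ≤ m)
    (h : R.form (R.root s) (R.root t) = -Real.cos (Real.pi / m)) :
    (R.refl s * R.refl t) ^ m = 1 := by
  have := R.alt_eq_mul_pow s t m
  rwa [alt_eq_alt hm h, left_eq_mul] at this

lemma alt_two_mul (s t : S) (k : ℕ) : R.alt s t (2 * k) = (R.refl s * R.refl t) ^ k := by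
  induction k with
  | zero => simp [alt]
  | succ k ih => rw [mul_add, mul_one, alt_succ, alt_succ, ih, mul_assoc, pow_succ]

lemma exists_eq_pow_of_mem_parabolic {s t : S} {m : ℕ} (hm : 2 ≤ m)
    (h : R.form (R.root s) (R.root t) = -Real.cos (Real.pi / m)) {g : V ≃ₗ[ℝ] V}
    (hg : g ∈ R.parabolic {s, t}) : ∃ k < m,
      g = (R.refl s * R.refl t) ^ k ∨ g = (R.refl s * R.refl t) ^ k * R.refl t := by
  have hs := R.refl_mul_self s
  have ht := R.refl_mul_self t
  have h1 := mul_pow_eq_one hm h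
  set ρ := R.refl s * R.refl t with hρ
  have hmod (k : ℕ) : ρ ^ k = ρ ^ (k % m) := by
    conv_lhs => rw [← Nat.mod_add_div k m, pow_add, pow_mul, h1, one_pow, mul_one]
  have hlt (k : ℕ) : k % m < m := Nat.mod_lt _ (by omega)
  have e1 : R.refl s = ρ * R.refl t := by rw [hρ, mul_assoc, ht, mul_one]
  have e2 : R.refl t * R.refl s = ρ ^ (m - 1) := by
    have : ρ * (R.refl t * R.refl s) = 1 := by
      rw [hρ, mul_assoc, ← mul_assoc (R.refl t), ht, one_mul, hs]
    have h3 : ρ * ρ ^ (m - 1) = 1 := by rw [← pow_succ', Nat.sub_add_cancel (by omega), h1]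
    exact mul_left_cancel (this.trans h3.symm)
  obtain ⟨n, hn⟩ := hg
  induction hn with
  | one => exact ⟨0, by omega, .inl (by simp)⟩
  | mul_refl _ hr ih =>
    obtain ⟨k, hk, rfl | rfl⟩ := ih <;> rcases hr with rfl | rfl
    · refine ⟨(k + 1) % m, hlt _, .inr ?_⟩
      rw [← hmod, pow_succ, mul_assoc, ← e1]
    · exact ⟨k, hk, .inr rfl⟩
    · refine ⟨(k + (m - 1)) % m, hlt _, .inl ?_⟩
      rw [← hmod, pow_add, mul_assoc, e2]
    · exact ⟨k, hk, .inl (by rw [mul_assoc, ht, mul_one])⟩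

lemma finite_parabolic {s t : S} {m : ℕ} (hm : 2 ≤ m)
    (h : R.form (R.root s) (R.root t) = -Real.cos (Real.pi / m)) :
    (R.parabolic {s, t} : Set (V ≃ₗ[ℝ] V)).Finite := by
  refine (((finite_Iio m).image fun k ↦ (R.refl s * R.refl t) ^ k).union
    ((finite_Iio m).image fun k ↦ (R.refl s * R.refl t) ^ k * R.refl t)).subset fun g hg ↦ ?_
  obtain ⟨k, hk, rfl | rfl⟩ := exists_eq_pow_of_mem_parabolic hm h hg
  · exact .inl ⟨k, hk, rfl⟩
  · exact .inr ⟨k, hk, rfl⟩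

variable (R) in
/-- The orbit of a vector under a parabolic subgroup. -/
def orbit (I : Set S) (v : V) : Set V := (fun g : V ≃ₗ[ℝ] V ↦ g v) '' R.parabolic I

lemma self_mem_orbit (I : Set S) (v : V) : v ∈ R.orbit I v := ⟨1, one_mem _, rfl⟩

lemma apply_mem_orbit {I : Set S} {v w : V} {g : V ≃ₗ[ℝ] V} (hg : g ∈ R.parabolic I)
    (hw : w ∈ R.orbit I v) : g w ∈ R.orbit I v := by
  obtain ⟨x, hx, rfl⟩ := hw
  exact ⟨g * x, mul_mem hg hx, rfl⟩

lemma form_apply {I : Set S} {g : V ≃ₗ[ℝ] V} (hg : g ∈ R.parabolic I) (u v : V) :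
    R.form (g u) (g v) = R.form u v :=
  hg.choose_spec.form_apply u v

lemma form_inv_left {I : Set S} {g : V ≃ₗ[ℝ] V} (hg : g ∈ R.parabolic I) (u v : V) :
    R.form (g⁻¹ u) v = R.form u (g v) :=
  hg.choose_spec.form_inv_left u v

lemma apply_eq_self {I : Set S} {g : V ≃ₗ[ℝ] V} (hg : g ∈ R.parabolic I) {v : V}
    (hv : ∀ s ∈ I, R.form v (R.root s) = 0) : g v = v :=
  hg.choose_spec.apply_eq_self hv

lemma ncard_orbit {s t : S} {m : ℕ} (hm : 2 ≤ m)
    (h : R.form (R.root s) (R.root t) = -Real.cos (Real.pi / m)) {v : V}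
    (hvs : R.form v (R.root s) ≠ 0) (hvt : R.form v (R.root t) = 0) :
    (R.orbit {s, t} v).ncard = m := by
  have hne (k : ℕ) (hk0 : 0 < k) (hkm : k < m) : ((R.refl s * R.refl t) ^ k) v ≠ v := by
    intro hfix
    set θ := Real.pi / m with hθ
    have hθm : m * θ = Real.pi := by rw [hθ]; field_simp
    have hθ0 : 0 < θ := by positivity
    have hsin : 0 < Real.sin θ := Real.sin_pos_of_pos_of_lt_pi hθ0
      (div_lt_self Real.pi_pos (by exact_mod_cast hm))
    rw [← alt_two_mul] at hfix
    have hI : ∀ r ∈ ({s, t} : Set S), r ∈ ({s, t} : Set S) := fun _ h ↦ h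
    have e1 : Real.sin θ * R.form v (R.root s) =
        Real.sin ((2 * k + 1) * θ) * R.form v (R.root s) := by
      have h1 := (R.isWord_alt (I := {s, t}) (s := s) (t := t) (by simp) (by simp)
        (2 * k)).form_apply v (R.root s)
      rw [hfix] at h1
      have h2 := congrArg (R.form v) (R.sin_smul_alt_root h (2 * k))
      simp only [even_two_mul, if_true, map_add, map_smul, smul_eq_mul, h1, hvt, mul_zero,
        add_zero] at h2
      rw [h2]; push_cast; rfl
    have hfix' : R.alt t s (2 * k) v = v := by
      have : R.alt t s (2 * k) * R.alt s t (2 * k) = 1 := by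
        rw [alt_two_mul, alt_two_mul,
          show R.refl t * R.refl s = (R.refl s * R.refl t)⁻¹ from ?_, inv_pow, inv_mul_cancel]
        rw [mul_inv_rev, inv_eq_of_mul_eq_one_left (R.refl_mul_self s),
          inv_eq_of_mul_eq_one_left (R.refl_mul_self t)]
      conv_lhs => rw [← hfix]
      rw [← LinearEquiv.mul_apply, this, LinearEquiv.coe_one, id]
    have e2 : Real.sin (2 * k * θ) * R.form v (R.root s) = 0 := by
      have h1 := (R.isWord_alt (I := {s, t}) (s := t) (t := s) (by simp) (by simp)
        (2 * k)).form_apply v (R.root t)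
      rw [hfix'] at h1
      have h2 := congrArg (R.form v) (R.sin_smul_alt_root ((R.symm _ _).trans h) (2 * k))
      simp only [even_two_mul, if_true, map_add, map_smul, smul_eq_mul, h1, hvt, mul_zero,
        zero_add] at h2
      rw [h2]; push_cast; rfl
    have e1' : Real.sin θ = Real.sin ((2 * k + 1) * θ) := mul_right_cancel₀ hvs e1
    have e2' : Real.sin (2 * k * θ) = 0 := (mul_eq_zero.1 e2).resolve_right hvs
    rw [show (2 * k + 1) * θ = 2 * k * θ + θ by ring, Real.sin_add, e2'] at e1'
    have hcos : Real.cos (2 * k * θ) = 1 := by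
      apply mul_right_cancel₀ hsin.ne'
      linarith
    have hk' : (k : ℝ) < m := by exact_mod_cast hkm
    have hk0' : (0 : ℝ) < k := by exact_mod_cast hk0
    obtain ⟨n, hn⟩ := (Real.cos_eq_one_iff _).1 hcos
    have h3 : (n : ℝ) * m = k := by
      have : (n : ℝ) * (2 * (m * θ)) = 2 * k * θ := by rw [hθm]; exact hn
      have : 2 * θ * (n * m) = 2 * θ * k := by linarith
      exact mul_left_cancel₀ (by positivity) this
    have h4 : n * m = k := by exact_mod_cast h3
    rcases le_or_gt n 0 with hn0 | hn0 <;> nlinarith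
  have horb : R.orbit {s, t} v = (fun k ↦ ((R.refl s * R.refl t) ^ k) v) '' Iio m := by
    ext w
    constructor
    · rintro ⟨g, hg, rfl⟩
      obtain ⟨k, hk, rfl | rfl⟩ := exists_eq_pow_of_mem_parabolic hm h hg
      · exact ⟨k, hk, rfl⟩
      · exact ⟨k, hk, by simp only [LinearEquiv.mul_apply _ (R.refl t), R.refl_eq_self hvt]⟩
    · rintro ⟨k, -, rfl⟩
      exact ⟨_, pow_mem (mul_mem (refl_mem_parabolic (by simp)) (refl_mem_parabolic (by simp))) k,
        rfl⟩
  have hinj (i j : ℕ) (hij : i < j) (hj : j < m) :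
      ((R.refl s * R.refl t) ^ i) v ≠ ((R.refl s * R.refl t) ^ j) v := by
    intro he
    refine hne (j - i) (by omega) (by omega) ?_
    apply ((R.refl s * R.refl t) ^ i).injective
    rw [he, ← LinearEquiv.mul_apply, ← pow_add, Nat.add_sub_cancel' hij.le]
  rw [horb, InjOn.ncard_image, ncard_eq_toFinset_card', toFinset_Iio, Nat.card_Iio]
  intro i hi j hj hij
  by_contra hne'
  rcases lt_or_gt_of_ne hne' with h' | h'
  · exact hinj i j h' hj hij
  · exact hinj j i h' hi hij.symm

lemma exists_mem_parabolic_form_nonneg {s t : S} {m : ℕ} (hm : 2 ≤ m)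
    (h : R.form (R.root s) (R.root t) = -Real.cos (Real.pi / m)) (v : V) :
    ∃ g ∈ R.parabolic {s, t}, 0 ≤ R.form (g v) (R.root s) ∧ 0 ≤ R.form (g v) (R.root t) := by
  obtain ⟨g, hg, hmax⟩ := Set.exists_max_image _
    (fun g : V ≃ₗ[ℝ] V ↦ R.form (g v) (R.root s + R.root t)) (finite_parabolic hm h)
    ⟨1, one_mem _⟩
  have hcos : Real.cos (Real.pi / m) < 1 := by
    refine (Real.cos_lt_cos_of_nonneg_of_le_pi le_rfl ?_ (by positivity)).trans_eq Real.cos_zero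
    exact div_le_self Real.pi_pos.le (by exact_mod_cast (by omega : 1 ≤ m))
  have h' := (R.symm _ _).trans h
  have key (r : S) (hr : r ∈ ({s, t} : Set S))
      (hpos : 0 < R.form (R.root r) (R.root s + R.root t)) : 0 ≤ R.form (g v) (R.root r) := by
    have := hmax _ (mul_mem (refl_mem_parabolic hr) hg)
    rw [LinearEquiv.mul_apply, R.refl_apply, map_sub, map_smul, LinearMap.sub_apply,
      LinearMap.smul_apply, smul_eq_mul] at this
    nlinarith
  refine ⟨g, hg, key s (by simp) ?_, key t (by simp) ?_⟩
  · rw [map_add, R.unit, h]; linarith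
  · rw [map_add, R.unit, h']; linarith

lemma IsWord.exists_refl_mul {I : Set S} {n : ℕ} {g : V ≃ₗ[ℝ] V} (hg : R.IsWord I (n + 1) g) :
    ∃ s ∈ I, ∃ g', R.IsWord I n g' ∧ g = R.refl s * g' := by
  induction n generalizing g with
  | zero =>
    cases hg with
    | mul_refl hg hs =>
      cases hg
      exact ⟨_, hs, 1, .one, by simp⟩
  | succ n ih =>
    cases hg with
    | mul_refl hg hs =>
      obtain ⟨t, ht, g', hg', rfl⟩ := ih hg
      exact ⟨t, ht, _, hg'.mul_refl hs, by rw [mul_assoc]⟩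

end UnitRoots

/-- A triangle of the hyperbolic plane with angles `π / 2`, `π / p` and `π / q`, in the hyperboloid
model, such that the vertex with angle `π / p` lies on the time axis. The roots are the normals of
its sides and `vertex` spans the ray through the vertex with angle `π / q`. -/
structure HyperbolicTriangle (p q : ℕ) extends UnitRoots (Fin 3) (Euc 2 × ℝ) where
  form_eq : ∀ u v, form u v = inner ℝ u.1 v.1 - u.2 * v.2
  three_le_left : 3 ≤ p
  three_le_right : 3 ≤ q
  form_zero_one : form (root 0) (root 1) = -Real.cos (Real.pi / p)
  form_one_two : form (root 1) (root 2) = -Real.cos (Real.pi / q)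
  form_zero_two : form (root 0) (root 2) = 0
  eq_zero_of_forall : ∀ v, (∀ i, form v (root i) = 0) → v = 0
  form_center_zero : form (0, 1) (root 0) = 0
  form_center_one : form (0, 1) (root 1) = 0
  form_center_two : 0 < form (0, 1) (root 2)
  vertex : Euc 2 × ℝ
  form_vertex_zero : 0 < form vertex (root 0)
  form_vertex_one : form vertex (root 1) = 0
  form_vertex_two : form vertex (root 2) = 0
  form_vertex_vertex : form vertex vertex < 0
  form_vertex_center : form vertex (0, 1) < 0

/-- The Lorentzian form on `ℝ² × ℝ`. -/
def lorentzForm : LinearMap.BilinForm ℝ (Euc 2 × ℝ) :=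
  LinearMap.mk₂ ℝ (fun u v ↦ inner ℝ u.1 v.1 - u.2 * v.2)
    (fun u v w ↦ by simp only [Prod.fst_add, Prod.snd_add, inner_add_left]; ring)
    (fun a u v ↦ by
      simp only [Prod.smul_fst, Prod.smul_snd, real_inner_smul_left, smul_eq_mul]; ring)
    (fun u v w ↦ by simp only [Prod.fst_add, Prod.snd_add, inner_add_right]; ring)
    (fun a u v ↦ by
      simp only [Prod.smul_fst, Prod.smul_snd, real_inner_smul_right, smul_eq_mul]; ring)

lemma lorentzForm_apply (u v : Euc 2 × ℝ) :
    lorentzForm u v = inner ℝ u.1 v.1 - u.2 * v.2 := rfl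

lemma lorentzForm_mk (a b c a' b' c' : ℝ) :
    lorentzForm (!₂[a, b], c) (!₂[a', b'], c') = a * a' + b * b' - c * c' := by
  simp [lorentzForm_apply, PiLp.inner_apply, Fin.sum_univ_two, mul_comm]

lemma nonempty_hyperbolicTriangle {p q : ℕ} (hp : 3 ≤ p) (hq : 3 ≤ q)
    (hpq : 4 < (p - 2) * (q - 2)) : Nonempty (HyperbolicTriangle p q) := by
  have hp' : (3 : ℝ) ≤ p := by exact_mod_cast hp
  have hq' : (3 : ℝ) ≤ q := by exact_mod_cast hq
  have hpq' : (4 : ℝ) < (p - 2) * (q - 2) := by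
    have : ((4 : ℕ) : ℝ) < ((p - 2) * (q - 2) : ℕ) := by exact_mod_cast hpq
    rwa [Nat.cast_mul, Nat.cast_sub (by omega), Nat.cast_sub (by omega)] at this
  have hsum : Real.pi / p + Real.pi / q < Real.pi / 2 := by
    rw [div_add_div _ _ (by positivity) (by positivity), div_lt_div_iff₀ (by positivity)
      (by positivity)]
    nlinarith [Real.pi_pos]
  have hα : 0 < Real.pi / p := by positivity
  have hβ : 0 < Real.pi / q := by positivity
  set α := Real.pi / p with hα'
  set β := Real.pi / q with hβ'
  have hsα : 0 < Real.sin α := Real.sin_pos_of_pos_of_lt_pi hα (by linarith)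
  have hsβ : 0 < Real.sin β := Real.sin_pos_of_pos_of_lt_pi hβ (by linarith)
  have hcα : 0 < Real.cos α := Real.cos_pos_of_mem_Ioo ⟨by linarith, by linarith⟩
  have hcβ : 0 < Real.cos β := Real.cos_pos_of_mem_Ioo ⟨by linarith, by linarith⟩
  have hcαβ : 0 < Real.cos (α + β) := Real.cos_pos_of_mem_Ioo ⟨by linarith, by linarith⟩
  rw [Real.cos_add] at hcαβ
  have tα := Real.sin_sq_add_cos_sq α
  have tβ := Real.sin_sq_add_cos_sq β
  set sα := Real.sin α
  set sβ := Real.sin β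
  set cα := Real.cos α
  set cβ := Real.cos β
  have hD : 0 < (cα * cβ) ^ 2 - (sα * sβ) ^ 2 := by
    have : 0 < sα * sβ := by positivity
    nlinarith
  set d := √((cα * cβ) ^ 2 - (sα * sβ) ^ 2)
  have hd : 0 < d := Real.sqrt_pos.2 hD
  have hd2 : d ^ 2 = (cα * cβ) ^ 2 - (sα * sβ) ^ 2 := Real.sq_sqrt hD.le
  obtain ⟨x, hx⟩ : ∃ x, x * sα = cα * cβ := ⟨cα * cβ / sα, by field_simp⟩
  obtain ⟨z, hz⟩ : ∃ z, z * sα = d := ⟨d / sα, by field_simp⟩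
  have hx0 : 0 < x := pos_of_mul_pos_left (hx ▸ by positivity) hsα.le
  have hz0 : 0 < z := pos_of_mul_pos_left (hz ▸ hd) hsα.le
  have hxz : x ^ 2 - z ^ 2 = sβ ^ 2 := by
    have : (x ^ 2 - z ^ 2) * sα ^ 2 = sβ ^ 2 * sα ^ 2 := by
      calc _ = (x * sα) ^ 2 - (z * sα) ^ 2 := by ring
        _ = _ := by rw [hx, hz, hd2]; ring
    exact mul_right_cancel₀ (by positivity) this
  have hcenter : ((0, 1) : Euc 2 × ℝ) = (!₂[0, 0], 1) := by
    congr 1; ext i; fin_cases i <;> rfl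
  refine ⟨{
    form := lorentzForm
    root := ![(!₂[sα, -cα], 0), (!₂[0, 1], 0), (!₂[-x, -cβ], -z)]
    symm := fun u v ↦ by rw [lorentzForm_apply, lorentzForm_apply, real_inner_comm, mul_comm]
    unit := fun s ↦ by
      fin_cases s <;> simp [lorentzForm_mk] <;> linarith
    form_eq := lorentzForm_apply
    three_le_left := hp
    three_le_right := hq
    form_zero_one := by simp [lorentzForm_mk, cα, hα']
    form_one_two := by simp [lorentzForm_mk, cβ, hβ']
    form_zero_two := by simp [lorentzForm_mk]; linarith
    eq_zero_of_forall := fun v hv ↦ ?_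
    form_center_zero := by rw [hcenter]; simp [lorentzForm_mk]
    form_center_one := by rw [hcenter]; simp [lorentzForm_mk]
    form_center_two := by rw [hcenter]; simpa [lorentzForm_mk] using hz0
    vertex := (!₂[z, 0], x)
    form_vertex_zero := by simp [lorentzForm_mk]; positivity
    form_vertex_one := by simp [lorentzForm_mk]
    form_vertex_two := by simp [lorentzForm_mk]; ring
    form_vertex_vertex := by simp [lorentzForm_mk]; nlinarith
    form_vertex_center := by rw [hcenter]; simpa [lorentzForm_mk] using hx0 }⟩
  obtain ⟨a, b, c, rfl⟩ : ∃ a b c, v = (!₂[a, b], c) :=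
    ⟨v.1 0, v.1 1, v.2, by ext i; fin_cases i <;> rfl; rfl⟩
  have h0 := hv 0
  have h1 := hv 1
  have h2 := hv 2
  simp only [Matrix.cons_val, lorentzForm_mk] at h0 h1 h2
  have hb : b = 0 := by linarith
  subst hb
  have ha : a = 0 := by
    refine (mul_eq_zero.1 ?_).resolve_right hsα.ne'
    linarith
  subst ha
  have hc : c = 0 := by
    refine (mul_eq_zero.1 ?_).resolve_right hz0.ne'
    linarith
  subst hc
  ext i
  · fin_cases i <;> rfl
  · rfl

/-- The affine function whose graph is the plane `{v | ⟪v, c⟫ = -h}`, where `⟪·, ·⟫` is the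
Lorentzian form. -/
def height (h : ℝ) (c : Euc 2 × ℝ) (y : Euc 2) : ℝ := (h + inner ℝ c.1 y) / c.2

/-- The set of points at which the upper envelope of the affine functions indexed by `C` is attained
at `c`. -/
def cell (h : ℝ) (C : Set (Euc 2 × ℝ)) (c : Euc 2 × ℝ) : Set (Euc 2) :=
  {y | ∀ c' ∈ C, height h c' y ≤ height h c y}

lemma continuous_height (h : ℝ) (c : Euc 2 × ℝ) : Continuous (height h c) := by
  unfold height; fun_prop

lemma height_combo (h : ℝ) (c : Euc 2 × ℝ) {a b : ℝ} (hab : a + b = 1) (x y : Euc 2) :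
    height h c (a • x + b • y) = a * height h c x + b * height h c y := by
  obtain rfl : b = 1 - a := by linarith
  simp only [height, inner_add_right, real_inner_smul_right]
  ring

lemma isClosed_cell (h : ℝ) (C : Set (Euc 2 × ℝ)) (c : Euc 2 × ℝ) : IsClosed (cell h C c) := by
  simp only [cell, ofPred_forall]
  exact isClosed_biInter fun c' _ ↦
    isClosed_le (continuous_height h c') (continuous_height h c)

lemma isExtreme_cell_inter {h : ℝ} {C : Set (Euc 2 × ℝ)} {c₁ c₂ : Euc 2 × ℝ} (h₁ : c₁ ∈ C)
    (h₂ : c₂ ∈ C) : IsExtreme ℝ (cell h C c₁) (cell h C c₁ ∩ cell h C c₂) := by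
  refine ⟨inter_subset_left, fun x hx y hy z hz hxyz ↦ ⟨hx, fun c hc ↦ ?_⟩⟩
  refine (hx c hc).trans ?_
  obtain ⟨a, b, ha, hb, hab, rfl⟩ := hxyz
  have h1 := hz.2 c₁ h₁
  rw [height_combo h _ hab, height_combo h _ hab] at h1
  have h2 := hx c₂ h₂
  have h3 := hy c₂ h₂
  by_contra! hlt
  nlinarith

lemma faceToFace_cell_image (h : ℝ) (C : Set (Euc 2 × ℝ)) : FaceToFace (cell h C '' C) := by
  rintro _ ⟨c₁, h₁, rfl⟩ _ ⟨c₂, h₂, rfl⟩ -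
  refine ⟨isExtreme_cell_inter h₁ h₂, ?_⟩
  rw [inter_comm]
  exact isExtreme_cell_inter h₂ h₁

lemma eq_of_interior_cell_inter_nonempty {h : ℝ} (hh : 0 < h) {C : Set (Euc 2 × ℝ)}
    (hC : ∀ c ∈ C, 0 < c.2) {c₁ c₂ : Euc 2 × ℝ} (h₁ : c₁ ∈ C) (h₂ : c₂ ∈ C)
    (hne : (interior (cell h C c₁) ∩ interior (cell h C c₂)).Nonempty) : c₁ = c₂ := by
  obtain ⟨y, hy⟩ := hne
  rw [← interior_inter, mem_interior_iff_mem_nhds] at hy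
  have heq : ∀ᶠ z in nhds y, height h c₁ z = height h c₂ z := by
    filter_upwards [hy] with z hz
    exact le_antisymm (hz.2 c₁ h₁) (hz.1 c₂ h₂)
  have hw₁ := hC c₁ h₁
  have hw₂ := hC c₂ h₂
  have key : ∀ᶠ z in nhds y, inner ℝ (c₂.2 • c₁.1 - c₁.2 • c₂.1) z = h * (c₁.2 - c₂.2) := by
    filter_upwards [heq] with z hz
    rw [height, height, div_eq_div_iff hw₁.ne' hw₂.ne'] at hz
    rw [inner_sub_left, real_inner_smul_left, real_inner_smul_left]
    linarith
  set u := c₂.2 • c₁.1 - c₁.2 • c₂.1 with hu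
  have hu0 : u = 0 := by
    have ht : Filter.Tendsto (fun t : ℝ ↦ y + t • u) (nhdsWithin 0 (Ioi 0)) (nhds y) := by
      have : Continuous fun t : ℝ ↦ y + t • u := by fun_prop
      have := this.tendsto 0
      simp only [zero_smul, add_zero] at this
      exact this.mono_left nhdsWithin_le_nhds
    obtain ⟨t, ht, ht0⟩ := ((ht.eventually key).and self_mem_nhdsWithin).exists
    rw [inner_add_right, key.self_of_nhds, real_inner_smul_right] at ht
    have : t * inner ℝ u u = 0 := by linarith
    exact inner_self_eq_zero.1 ((mul_eq_zero.1 this).resolve_left (ne_of_gt ht0))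
  have h0 := key.self_of_nhds
  rw [hu0, inner_zero_left] at h0
  have hw : c₁.2 = c₂.2 := by
    have := (mul_eq_zero.1 h0.symm).resolve_left hh.ne'
    linarith
  rw [hu, hw, ← smul_sub] at hu0
  exact Prod.ext (sub_eq_zero.1 ((smul_eq_zero.1 hu0).resolve_left hw₂.ne')) hw

/-- Conditions on a set of future timelike vectors under which the upper envelope of the affine
functions it defines is attained locally by finitely many of them. -/
structure IsEnvelope (h : ℝ) (C : Set (Euc 2 × ℝ)) : Prop where
  pos : 0 < h
  time_pos : ∀ c ∈ C, 0 < c.2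
  norm_le : ∀ c ∈ C, ‖c.1‖ ≤ c.2
  finite : ∀ N : ℝ, {c ∈ C | c.2 ≤ N}.Finite
  exists_lt : ∀ y, ∃ c ∈ C, ‖y‖ < height h c y

namespace IsEnvelope

variable {h : ℝ} {C : Set (Euc 2 × ℝ)}

lemma time_le (H : IsEnvelope h C) {c : Euc 2 × ℝ} (hc : c ∈ C) {y : Euc 2} {ε : ℝ} (hε : 0 < ε)
    (hy : ‖y‖ + ε ≤ height h c y) : c.2 ≤ h / ε := by
  have hw := H.time_pos c hc
  have h1 : inner ℝ c.1 y ≤ c.2 * ‖y‖ := (real_inner_le_norm _ _).trans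
    (mul_le_mul_of_nonneg_right (H.norm_le c hc) (norm_nonneg _))
  rw [height, le_div_iff₀ hw] at hy
  rw [le_div_iff₀ hε]
  linarith

lemma exists_mem_cell (H : IsEnvelope h C) (y : Euc 2) : ∃ c ∈ C, y ∈ cell h C c := by
  obtain ⟨c₀, hc₀, hy⟩ := H.exists_lt y
  have hfin : {c ∈ C | height h c₀ y ≤ height h c y}.Finite := by
    refine (H.finite (h / (height h c₀ y - ‖y‖))).subset fun c hc ↦ ⟨hc.1, ?_⟩
    exact H.time_le hc.1 (y := y) (by linarith) (by linarith [hc.2])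
  obtain ⟨c, hc, hmax⟩ := exists_max_image _ (fun c ↦ height h c y) hfin ⟨c₀, hc₀, le_rfl⟩
  refine ⟨c, hc.1, fun c' hc' ↦ ?_⟩
  by_contra! hlt
  exact hlt.not_ge (hmax c' ⟨hc', hc.2.trans hlt.le⟩)

lemma finite_cell_inter (H : IsEnvelope h C) {K : Set (Euc 2)} (hK : IsCompact K) :
    {c ∈ C | (cell h C c ∩ K).Nonempty}.Finite := by
  refine hK.induction_on (p := fun K ↦ {c ∈ C | (cell h C c ∩ K).Nonempty}.Finite) (by simp)
    (fun s t hst ht ↦ ht.subset fun c hc ↦ ⟨hc.1, hc.2.mono (inter_subset_inter_right _ hst)⟩)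
    (fun s t hs ht ↦ (hs.union ht).subset ?_) fun y _ ↦ ?_
  · rintro c ⟨hc, x, hx, hx' | hx'⟩
    · exact .inl ⟨hc, x, hx, hx'⟩
    · exact .inr ⟨hc, x, hx, hx'⟩
  · obtain ⟨c₀, hc₀, hy⟩ := H.exists_lt y
    set ε := (height h c₀ y - ‖y‖) / 2 with hε
    have hcont : Continuous fun z : Euc 2 ↦ ‖z‖ + ε := by fun_prop
    have hev : ∀ᶠ z in nhds y, ‖z‖ + ε < height h c₀ z :=
      (hcont.tendsto y).eventually_lt ((continuous_height h c₀).tendsto y) (by linarith)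
    refine ⟨_, mem_nhdsWithin_of_mem_nhds hev, ?_⟩
    refine (H.finite (h / ε)).subset fun c hc ↦ ⟨hc.1, ?_⟩
    obtain ⟨z, hz, hz'⟩ := hc.2
    exact H.time_le hc.1 (y := z) (by linarith) (hz'.le.trans (hz c₀ hc₀))

lemma isTiling (H : IsEnvelope h C) : IsTiling (cell h C '' C) := by
  refine ⟨?_, ?_, ?_⟩
  · rintro _ ⟨c, -, rfl⟩
    exact isClosed_cell h C c
  · refine eq_univ_of_forall fun y ↦ ?_
    obtain ⟨c, hc, hy⟩ := H.exists_mem_cell y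
    exact ⟨_, mem_image_of_mem _ hc, hy⟩
  · rintro _ ⟨c₁, h₁, rfl⟩ _ ⟨c₂, h₂, rfl⟩ hne
    refine not_nonempty_iff_eq_empty.1 fun hne' ↦ hne ?_
    rw [eq_of_interior_cell_inter_nonempty H.pos H.time_pos h₁ h₂ hne']

lemma locallyFiniteTiling (H : IsEnvelope h C) : LocallyFiniteTiling (cell h C '' C) := fun K hK ↦ by
  refine ((H.finite_cell_inter hK).image (cell h C)).subset ?_
  rintro _ ⟨⟨c, hc, rfl⟩, hcK⟩
  exact mem_image_of_mem _ ⟨hc, hcK⟩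

end IsEnvelope

lemma cos_pi_div_pos {p : ℕ} (hp : 3 ≤ p) : 0 < Real.cos (Real.pi / p) := by
  have hp : (3 : ℝ) ≤ p := by exact_mod_cast hp
  have : Real.pi / p < Real.pi / 2 := by
    gcongr; linarith
  exact Real.cos_pos_of_mem_Ioo ⟨by linarith [Real.pi_pos, show 0 < Real.pi / p by positivity], this⟩

namespace HyperbolicTriangle

variable {p q : ℕ} (T : HyperbolicTriangle p q)

lemma isCoxeter : T.IsCoxeter := by
  have h₂ : T.form (T.root 0) (T.root 2) = -Real.cos (Real.pi / (2 : ℕ)) := by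
    simp [T.form_zero_two]
  have hp : 2 ≤ p := by linarith [T.three_le_left]
  have hq : 2 ≤ q := by linarith [T.three_le_right]
  intro s t hst
  fin_cases s <;> fin_cases t
  · exact absurd rfl hst
  · exact ⟨p, hp, T.form_zero_one⟩
  · exact ⟨2, le_rfl, h₂⟩
  · exact ⟨p, hp, (T.symm _ _).trans T.form_zero_one⟩
  · exact absurd rfl hst
  · exact ⟨q, hq, T.form_one_two⟩
  · exact ⟨2, le_rfl, (T.symm _ _).trans h₂⟩
  · exact ⟨q, hq, (T.symm _ _).trans T.form_one_two⟩
  · exact absurd rfl hst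

lemma center_mem_chamber : (0, 1) ∈ T.chamber := fun s ↦ by
  fin_cases s
  exacts [T.form_center_zero.ge, T.form_center_one.ge, T.form_center_two.le]

lemma vertex_mem_chamber : T.vertex ∈ T.chamber := fun s ↦ by
  fin_cases s
  exacts [T.form_vertex_zero.le, T.form_vertex_one.ge, T.form_vertex_two.ge]

lemma form_center (v : Euc 2 × ℝ) : T.form v (0, 1) = -v.2 := by simp [T.form_eq]

lemma snd_eq (v : Euc 2 × ℝ) : v.2 = -T.form v (0, 1) := by rw [form_center, neg_neg]

lemma vertex_snd_pos : 0 < T.vertex.2 := by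
  rw [T.snd_eq]; linarith [T.form_vertex_center]

lemma apply_center {g : (Euc 2 × ℝ) ≃ₗ[ℝ] Euc 2 × ℝ} (hg : g ∈ T.parabolic {0, 1}) :
    g (0, 1) = (0, 1) :=
  UnitRoots.apply_eq_self hg fun s hs ↦ by
    obtain rfl | rfl := hs
    exacts [T.form_center_zero, T.form_center_one]

lemma snd_apply {g : (Euc 2 × ℝ) ≃ₗ[ℝ] Euc 2 × ℝ} (hg : g ∈ T.parabolic {0, 1})
    (v : Euc 2 × ℝ) : (g v).2 = v.2 := by
  rw [T.snd_eq, T.snd_eq v, ← UnitRoots.form_apply hg v, T.apply_center hg]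

/-- The orbit of the centre, to which the tiles will correspond. -/
def centers : Set (Euc 2 × ℝ) := T.orbit univ (0, 1)

lemma form_self_of_mem_centers {c : Euc 2 × ℝ} (hc : c ∈ T.centers) : T.form c c = -1 := by
  obtain ⟨g, hg, rfl⟩ := hc
  exact (UnitRoots.form_apply hg _ _).trans (by simp [T.form_center])

lemma one_le_snd {c : Euc 2 × ℝ} (hc : c ∈ T.centers) : 1 ≤ c.2 := by
  obtain ⟨g, ⟨n, hg⟩, rfl⟩ := hc
  have := UnitRoots.isPos_sub_apply T.isCoxeter T.center_mem_chamber hg _ T.center_mem_chamber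
  rw [map_sub, T.symm _ (g _), T.form_center, T.form_center] at this
  linarith

lemma norm_sq_of_mem_centers {c : Euc 2 × ℝ} (hc : c ∈ T.centers) :
    ‖c.1‖ ^ 2 = c.2 ^ 2 - 1 := by
  have := T.form_self_of_mem_centers hc
  rw [T.form_eq, real_inner_self_eq_norm_sq] at this
  linarith

/-- A lower bound for the distance between distinct points of `centers`. -/
def gap : ℝ := 2 * T.form (0, 1) (T.root 2) ^ 2

lemma gap_pos : 0 < T.gap := by have := T.form_center_two; unfold gap; positivity

lemma one_add_gap_le_snd {c : Euc 2 × ℝ} (hc : c ∈ T.centers) (hne : c ≠ (0, 1)) :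
    1 + T.gap ≤ c.2 := by
  classical
  have hex : ∃ n, ∃ x ∈ T.parabolic {0, 1}, ∃ g, T.IsWord univ n g ∧ x (g (0, 1)) = c := by
    obtain ⟨g, ⟨n, hg⟩, rfl⟩ := hc
    exact ⟨n, 1, one_mem _, g, hg, rfl⟩
  obtain ⟨x, hx, g, hg, rfl⟩ := Nat.find_spec hex
  have hmin (i : ℕ) (hi : i < Nat.find hex) : ¬ T.IsWord univ i g := fun hw ↦
    Nat.find_min hex hi ⟨x, hx, g, hw, rfl⟩
  generalize hn : Nat.find hex = n at hg hmin
  cases n with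
  | zero =>
    cases hg
    exact absurd (T.apply_center hx) hne
  | succ n =>
    obtain ⟨s, -, g', hg', rfl⟩ := hg.exists_refl_mul
    have hs : s = 2 := by
      by_contra hs
      refine Nat.find_min hex (m := n) (by omega)
        ⟨_, mul_mem hx (UnitRoots.refl_mem_parabolic (s := s) ?_), g', hg', rfl⟩
      fin_cases s
      exacts [.inl rfl, .inr rfl, absurd rfl hs]
    subst hs
    have := UnitRoots.isPos_sub_refl_mul_apply T.isCoxeter T.center_mem_chamber hg' hmin _
      T.center_mem_chamber
    rw [map_sub, map_sub, map_smul, T.symm _ ((T.refl 2 * g') _), T.form_center, T.form_center,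
      smul_eq_mul] at this
    rw [T.snd_apply hx, gap]
    linarith

lemma gap_le_form {c c' : Euc 2 × ℝ} (hc : c ∈ T.centers) (hc' : c' ∈ T.centers) (hne : c ≠ c') :
    1 + T.gap ≤ -T.form c c' := by
  obtain ⟨g, hg, rfl⟩ := hc
  have h := T.one_add_gap_le_snd (UnitRoots.apply_mem_orbit (inv_mem hg) hc') fun h ↦ hne <| by
    simp [← h]
  rwa [T.snd_eq, UnitRoots.form_inv_left hg, T.symm] at h

lemma gap_le_dist_sq {c c' : Euc 2 × ℝ} (hc : c ∈ T.centers) (hc' : c' ∈ T.centers)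
    (hne : c ≠ c') : 2 * T.gap ≤ dist c.1 c'.1 ^ 2 := by
  have h := T.gap_le_form hc hc' hne
  have h1 := T.form_self_of_mem_centers hc
  have h2 := T.form_self_of_mem_centers hc'
  rw [T.form_eq] at h h1 h2
  rw [dist_eq_norm, ← real_inner_self_eq_norm_sq, inner_sub_left, inner_sub_right, inner_sub_right,
    real_inner_comm c.1 c'.1]
  nlinarith [sq_nonneg (c.2 - c'.2)]

lemma finite_centers (N : ℝ) : {c ∈ T.centers | c.2 ≤ N}.Finite := by
  have hgap := T.gap_pos
  have hsep {c c' : Euc 2 × ℝ} (hc : c ∈ T.centers) (hc' : c' ∈ T.centers) (hne : c ≠ c') :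
      √(2 * T.gap) ≤ dist c.1 c'.1 :=
    (Real.sqrt_le_left dist_nonneg).2 (T.gap_le_dist_sq hc hc' hne)
  have hpos : 0 < √(2 * T.gap) := by positivity
  have hinj : InjOn Prod.fst T.centers := fun c hc c' hc' h ↦ by
    by_contra hne
    have := hsep hc hc' hne
    rw [h, dist_self] at this
    linarith
  have hpw : (Prod.fst '' T.centers).Pairwise fun x y ↦ √(2 * T.gap) ≤ dist x y := by
    rintro _ ⟨c, hc, rfl⟩ _ ⟨c', hc', rfl⟩ hne
    exact hsep hc hc' fun h ↦ hne (h ▸ rfl)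
  have hdisc : DiscreteTopology (Prod.fst '' T.centers) :=
    .of_forall_le_dist hpos fun x y hxy ↦ hpw x.2 y.2 fun h ↦ hxy (Subtype.ext h)
  have hfin := Metric.finite_isBounded_inter_isClosed ⟨hdisc⟩
    (Metric.isBounded_closedBall (x := (0 : Euc 2)) (r := N))
    (Metric.isClosed_of_pairwise_le_dist hpos hpw)
  refine Finite.of_finite_image (f := Prod.fst) (hfin.subset ?_) (hinj.mono fun c hc ↦ hc.1)
  rintro _ ⟨c, ⟨hc, hcN⟩, rfl⟩
  refine ⟨?_, mem_image_of_mem _ hc⟩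
  rw [mem_closedBall_zero_iff]
  refine le_trans (abs_le_of_sq_le_sq' ?_ (by linarith [T.one_le_snd hc])).2 hcN
  linarith [T.norm_sq_of_mem_centers hc]

lemma eq_combo (z : Euc 2 × ℝ) :
    z = (T.form z (T.root 0) / T.form T.vertex (T.root 0)) • T.vertex +
      (T.form z (T.root 1) / (2 * T.form T.vertex (T.root 0) * Real.cos (Real.pi / p))) •
        (T.vertex + T.refl 0 T.vertex) +
      (T.form z (T.root 2) / T.form (0, 1) (T.root 2)) • (0, 1) := by
  have h0 := T.form_vertex_zero
  have h2 := T.form_center_two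
  have hcos := cos_pi_div_pos T.three_le_left
  refine sub_eq_zero.1 (T.eq_zero_of_forall _ fun i ↦ ?_)
  simp only [map_sub, map_add, map_smul, LinearMap.sub_apply, LinearMap.add_apply,
    LinearMap.smul_apply, smul_eq_mul, T.refl_apply]
  fin_cases i
  · simp only [Fin.zero_eta, T.unit, T.form_center_zero]
    field_simp
    ring
  · simp only [Fin.mk_one, T.form_zero_one, T.form_vertex_one, T.form_center_one]
    field_simp
    ring
  · simp only [Fin.reduceFinMk, T.form_zero_two, T.form_vertex_two]
    field_simp
    ring

lemma two_mul_mul_le_neg_of_quadratic {s γ h τ : ℝ} (hs : 0 ≤ s) (hh : 0 < h) (hτ : 0 < τ)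
    (hle : s ^ 2 * τ + 2 * γ * (s * h) + γ ^ 2 ≤ 0) (hN : h ≤ s * h + γ) : 2 * h * γ ≤ -τ := by
  have hγ : γ < 0 := by
    by_contra! hγ0
    have h1 : 0 ≤ 2 * γ * (s * h) := by positivity
    have h2 : 0 ≤ s ^ 2 * τ := by positivity
    have h3 : γ = 0 := pow_eq_zero_iff two_ne_zero |>.1 (by linarith [sq_nonneg γ])
    have h4 : s = 0 := by
      refine pow_eq_zero_iff two_ne_zero |>.1 ((mul_eq_zero.1 ?_).resolve_right hτ.ne')
      linarith [sq_nonneg γ]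
    subst h3 h4
    linarith
  have hs1 : 1 ≤ s := by
    by_contra! hlt
    nlinarith
  refine le_of_mul_le_mul_left (a := s) ?_ (by linarith)
  nlinarith [mul_nonneg (mul_nonneg hs (sub_nonneg.2 hs1)) hτ.le, sq_nonneg γ]

lemma form_height {h : ℝ} {c : Euc 2 × ℝ} (hc : 0 < c.2) (y : Euc 2) (t : ℝ) :
    T.form (y, t) c + h = (height h c y - t) * c.2 := by
  rw [T.form_eq, height, real_inner_comm]
  field_simp
  ring

lemma form_vertex_combo (a b : ℝ) :
    T.form (a • T.vertex + b • (T.vertex + T.refl 0 T.vertex))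
      (a • T.vertex + b • (T.vertex + T.refl 0 T.vertex)) =
    (a + 2 * b) ^ 2 * T.form T.vertex T.vertex -
      4 * (a + b) * b * T.form T.vertex (T.root 0) ^ 2 := by
  simp only [map_sub, map_add, map_smul, LinearMap.sub_apply, LinearMap.add_apply,
    LinearMap.smul_apply, smul_eq_mul, T.refl_apply, T.unit, T.symm (T.root 0) T.vertex]
  ring

lemma snd_refl_zero (v : Euc 2 × ℝ) : (T.refl 0 v).2 = v.2 :=
  T.snd_apply (UnitRoots.refl_mem_parabolic (by simp)) v

/-- The least decrease of the time coordinate of a lightlike vector in one step of the reduction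
towards the triangle. -/
def descent : ℝ :=
  T.form (0, 1) (T.root 2) ^ 2 * -T.form T.vertex T.vertex / T.vertex.2

lemma descent_pos : 0 < T.descent := by
  have h1 := T.form_center_two
  have h2 := T.form_vertex_vertex
  have h3 := T.vertex_snd_pos
  rw [← neg_pos] at h2
  unfold descent
  positivity

lemma snd_refl_two_le {m : Euc 2 × ℝ} (h0 : 0 ≤ T.form m (T.root 0))
    (h1 : 0 ≤ T.form m (T.root 1)) (hm : T.form m m = 0) (hv : T.vertex.2 ≤ m.2) :
    (T.refl 2 m).2 ≤ m.2 - T.descent := by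
  have hX := T.form_vertex_zero
  have hκ := T.form_center_two
  have hcos := cos_pi_div_pos T.three_le_left
  have hτ := T.form_vertex_vertex
  have hh := T.vertex_snd_pos
  set κ := T.form (0, 1) (T.root 2) with hκ'
  set α := T.form m (T.root 0) / T.form T.vertex (T.root 0) with hα'
  set β := T.form m (T.root 1) / (2 * T.form T.vertex (T.root 0) * Real.cos (Real.pi / p)) with hβ'
  set γ := T.form m (T.root 2) / κ with hγ'
  have hα : 0 ≤ α := by positivity
  have hβ : 0 ≤ β := by positivity
  have hmc := T.eq_combo m
  rw [← hκ', ← hα', ← hβ', ← hγ'] at hmc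
  have hγ : T.form m (T.root 2) = γ * κ := by rw [hγ']; field_simp
  have hsnd : m.2 = (α + 2 * β) * T.vertex.2 + γ := by
    rw [hmc]
    simp [T.snd_refl_zero]
    ring
  have hrefl : (T.refl 2 m).2 = m.2 + 2 * κ ^ 2 * γ := by
    rw [T.refl_apply, hγ, Prod.snd_sub, Prod.smul_snd, T.snd_eq (T.root 2), T.symm, ← hκ',
      smul_eq_mul]
    ring
  set s := α + 2 * β with hs'
  have hs : 0 ≤ s := by positivity
  have hquad : s ^ 2 * T.form T.vertex T.vertex - 4 * (α + β) * β * T.form T.vertex (T.root 0) ^ 2 -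
      2 * γ * (s * T.vertex.2) - γ ^ 2 = 0 := by
    rw [← hm, hmc]
    set w := α • T.vertex + β • (T.vertex + T.refl 0 T.vertex) with hw
    have hw2 : w.2 = s * T.vertex.2 := by simp [hw, T.snd_refl_zero]; ring
    have e : T.form (w + γ • (0, 1)) (w + γ • (0, 1)) = T.form w w - 2 * γ * w.2 - γ ^ 2 := by
      simp only [map_add, map_smul, LinearMap.add_apply, LinearMap.smul_apply, smul_eq_mul,
        T.symm (0, 1) w, T.form_center]
      ring
    rw [e, hw2, hw, T.form_vertex_combo]
  have hle : s ^ 2 * -T.form T.vertex T.vertex + 2 * γ * (s * T.vertex.2) + γ ^ 2 ≤ 0 := by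
    have : 0 ≤ 4 * (α + β) * β * T.form T.vertex (T.root 0) ^ 2 := by positivity
    linarith
  set τ := T.form T.vertex T.vertex with hτ'
  set h := T.vertex.2 with hh'
  have hγle : 2 * h * γ ≤ -(-τ) :=
    two_mul_mul_le_neg_of_quadratic hs hh (by linarith) hle (hsnd ▸ hv)
  have hd : T.descent = κ ^ 2 * (-τ / h) := by rw [descent, hκ']; ring
  have hd' : -τ / h ≤ -(2 * γ) := by rw [div_le_iff₀ hh]; linarith
  rw [hrefl, hd]
  nlinarith [mul_le_mul_of_nonneg_left hd' (sq_nonneg κ)]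

lemma exists_snd_lt {n : Euc 2 × ℝ} (hn : T.form n n = 0) :
    ∃ g ∈ T.parabolic univ, (g n).2 < T.vertex.2 := by
  by_contra! hge
  have key (k : ℕ) : ∃ g ∈ T.parabolic univ, (g n).2 ≤ n.2 - k * T.descent := by
    induction k with
    | zero => exact ⟨1, one_mem _, by simp⟩
    | succ k ih =>
      obtain ⟨g, hg, hle⟩ := ih
      obtain ⟨x, hx, h0, h1⟩ := UnitRoots.exists_mem_parabolic_form_nonneg
        (by linarith [T.three_le_left]) T.form_zero_one (g n)
      have hxg : x * g ∈ T.parabolic univ :=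
        mul_mem (UnitRoots.parabolic_mono (subset_univ _) hx) hg
      refine ⟨T.refl 2 * (x * g),
        mul_mem (UnitRoots.refl_mem_parabolic (mem_univ _)) hxg, ?_⟩
      have h := T.snd_refl_two_le h0 h1 ((UnitRoots.form_apply hxg n n).trans hn) (hge _ hxg)
      rw [T.snd_apply hx] at h
      simp only [LinearEquiv.mul_apply]
      push_cast
      linarith
  obtain ⟨k, hk⟩ := exists_nat_gt ((n.2 - T.vertex.2) / T.descent)
  obtain ⟨g, hg, hle⟩ := key k
  rw [div_lt_iff₀ T.descent_pos] at hk
  linarith [hge g hg]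

lemma snd_pos {c : Euc 2 × ℝ} (hc : c ∈ T.centers) : 0 < c.2 := by linarith [T.one_le_snd hc]

lemma isEnvelope : IsEnvelope T.vertex.2 T.centers where
  pos := T.vertex_snd_pos
  time_pos _ hc := T.snd_pos hc
  norm_le c hc := by
    refine (abs_le_of_sq_le_sq' ?_ (T.snd_pos hc).le).2
    linarith [T.norm_sq_of_mem_centers hc]
  finite := T.finite_centers
  exists_lt y := by
    obtain ⟨g, hg, hlt⟩ := T.exists_snd_lt (n := (y, ‖y‖)) (by
      rw [T.form_eq, real_inner_self_eq_norm_sq]; ring)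
    have hc : g⁻¹ (0, 1) ∈ T.centers := ⟨_, inv_mem hg, rfl⟩
    refine ⟨_, hc, ?_⟩
    have hw := T.snd_pos hc
    have h := T.form_height (h := T.vertex.2) hw y ‖y‖
    rw [T.symm, UnitRoots.form_inv_left hg, T.symm, T.form_center] at h
    by_contra! hle
    nlinarith

/-- The face of the convex hull of the orbit of `T.vertex` that is cut out by `c`. -/
def face (c : Euc 2 × ℝ) : Set (Euc 2 × ℝ) :=
  {v | T.form v c = -T.vertex.2 ∧ ∀ c' ∈ T.centers, T.form v c' ≤ -T.vertex.2}

/-- The tile corresponding to `c`. -/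
def tile (c : Euc 2 × ℝ) : Set (Euc 2) := cell T.vertex.2 T.centers c

lemma form_eq_neg_iff {c : Euc 2 × ℝ} (hc : c ∈ T.centers) (v : Euc 2 × ℝ) :
    T.form v c = -T.vertex.2 ↔ v.2 = height T.vertex.2 c v.1 := by
  have hw := T.snd_pos hc
  have h := T.form_height (h := T.vertex.2) hw v.1 v.2
  rw [← add_eq_zero_iff_eq_neg, h, mul_eq_zero, or_iff_left hw.ne', sub_eq_zero, eq_comm]

lemma form_le_neg_iff {c : Euc 2 × ℝ} (hc : c ∈ T.centers) (v : Euc 2 × ℝ) :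
    T.form v c ≤ -T.vertex.2 ↔ height T.vertex.2 c v.1 ≤ v.2 := by
  have hw := T.snd_pos hc
  have h := T.form_height (h := T.vertex.2) hw v.1 v.2
  rw [Prod.mk.eta] at h
  constructor <;> intro h' <;> nlinarith

lemma mem_face {c v : Euc 2 × ℝ} (hc : c ∈ T.centers) :
    v ∈ T.face c ↔ v.2 = height T.vertex.2 c v.1 ∧ v.1 ∈ T.tile c := by
  rw [face, mem_ofPred, T.form_eq_neg_iff hc v]
  refine and_congr_right fun h ↦ forall₂_congr fun c' hc' ↦ ?_
  rw [T.form_le_neg_iff hc', ← h]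

lemma image_face {c : Euc 2 × ℝ} (hc : c ∈ T.centers) : Prod.fst '' T.face c = T.tile c := by
  ext y
  constructor
  · rintro ⟨v, hv, rfl⟩
    exact ((T.mem_face hc).1 hv).2
  · exact fun hy ↦ ⟨(y, height T.vertex.2 c y), (T.mem_face hc).2 ⟨rfl, hy⟩, rfl⟩

lemma apply_mem_centers {g : (Euc 2 × ℝ) ≃ₗ[ℝ] Euc 2 × ℝ} (hg : g ∈ T.parabolic univ)
    {c : Euc 2 × ℝ} (hc : c ∈ T.centers) : g c ∈ T.centers :=
  UnitRoots.apply_mem_orbit hg hc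

lemma center_mem_centers : (0, 1) ∈ T.centers := UnitRoots.self_mem_orbit _ _

lemma apply_mem_face {g : (Euc 2 × ℝ) ≃ₗ[ℝ] Euc 2 × ℝ} (hg : g ∈ T.parabolic univ)
    {c v : Euc 2 × ℝ} (hv : v ∈ T.face c) : g v ∈ T.face (g c) := by
  refine ⟨(UnitRoots.form_apply hg v c).trans hv.1, fun c' hc' ↦ ?_⟩
  rw [← inv_inv g, UnitRoots.form_inv_left (inv_mem hg)]
  exact hv.2 _ (T.apply_mem_centers (inv_mem hg) hc')

lemma tile_apply {g : (Euc 2 × ℝ) ≃ₗ[ℝ] Euc 2 × ℝ} (hg : g ∈ T.parabolic univ)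
    {c : Euc 2 × ℝ} (hc : c ∈ T.centers) :
    T.tile (g c) = (fun v ↦ (g v).1) '' T.face c := by
  rw [← T.image_face (T.apply_mem_centers hg hc), ← image_image Prod.fst g]
  congr 1
  ext v
  constructor
  · exact fun hv ↦ ⟨g⁻¹ v, by simpa using T.apply_mem_face (inv_mem hg) hv, by simp⟩
  · rintro ⟨v, hv, rfl⟩
    exact T.apply_mem_face hg hv

lemma injOn_face {g : (Euc 2 × ℝ) ≃ₗ[ℝ] Euc 2 × ℝ} (hg : g ∈ T.parabolic univ)
    {c : Euc 2 × ℝ} (hc : c ∈ T.centers) : InjOn (fun v ↦ (g v).1) (T.face c) := fun v hv w hw h ↦ by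
  have hgc := T.apply_mem_centers hg hc
  have h1 := ((T.mem_face hgc).1 (T.apply_mem_face hg hv)).1
  have h2 := ((T.mem_face hgc).1 (T.apply_mem_face hg hw)).1
  refine g.injective (Prod.ext h ?_)
  rw [h1, h2]
  exact congrArg _ h

lemma convex_face (c : Euc 2 × ℝ) : Convex ℝ (T.face c) := by
  intro v hv w hw a b ha hb hab
  obtain rfl : b = 1 - a := by linarith
  refine ⟨?_, fun c' hc' ↦ ?_⟩
  · simp only [map_add, map_smul, LinearMap.add_apply, LinearMap.smul_apply, smul_eq_mul, hv.1, hw.1]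
    ring
  · simp only [map_add, map_smul, LinearMap.add_apply, LinearMap.smul_apply, smul_eq_mul]
    nlinarith [hv.2 c' hc', hw.2 c' hc']

/-- The vertices of the face cut out by the centre. -/
def vertices : Set (Euc 2 × ℝ) := T.orbit {0, 1} T.vertex

lemma two_le_left {p q : ℕ} (T : HyperbolicTriangle p q) : 2 ≤ p := by linarith [T.three_le_left]

lemma ncard_vertices : T.vertices.ncard = p :=
  UnitRoots.ncard_orbit T.two_le_left T.form_zero_one T.form_vertex_zero.ne' T.form_vertex_one

lemma finite_vertices : T.vertices.Finite :=
  finite_of_ncard_pos (by rw [ncard_vertices]; linarith [T.two_le_left])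

lemma vertex_mem_vertices : T.vertex ∈ T.vertices := UnitRoots.self_mem_orbit _ _

lemma snd_of_mem_vertices {v : Euc 2 × ℝ} (hv : v ∈ T.vertices) : v.2 = T.vertex.2 := by
  obtain ⟨g, hg, rfl⟩ := hv
  exact T.snd_apply hg _

lemma vertices_subset_face : T.vertices ⊆ T.face (0, 1) := by
  intro v hv
  refine ⟨by rw [T.form_center, T.snd_of_mem_vertices hv], fun c hc ↦ ?_⟩
  obtain ⟨x, hx, rfl⟩ := hv
  have hx' := UnitRoots.parabolic_mono (subset_univ _) hx
  obtain ⟨g, ⟨n, hg⟩, h⟩ := T.apply_mem_centers (inv_mem hx') hc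
  have := UnitRoots.isPos_sub_apply T.isCoxeter T.center_mem_chamber hg _ T.vertex_mem_chamber
  simp only at h
  rw [h, map_sub, T.symm _ (x⁻¹ c), UnitRoots.form_inv_left hx', T.form_center, T.symm] at this
  linarith

lemma smul_center_mem : T.vertex.2 • ((0, 1) : Euc 2 × ℝ) ∈ convexHull ℝ T.vertices := by
  have hfin := T.finite_vertices
  set Y := hfin.toFinset with hY
  have hcard : (0 : ℝ) < Y.card := by
    rw [← ncard_eq_toFinset_card _ hfin, T.ncard_vertices]
    exact_mod_cast (by linarith [T.two_le_left])
  set v : Euc 2 × ℝ := ∑ y ∈ Y, (1 / (Y.card : ℝ)) • y with hv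
  have hmem : v ∈ convexHull ℝ T.vertices := by
    refine (convex_convexHull ℝ _).sum_mem (fun _ _ ↦ by positivity) ?_ fun y hy ↦
      subset_convexHull ℝ _ (hfin.mem_toFinset.1 hy)
    rw [Finset.sum_const, nsmul_eq_mul]
    field_simp
  have horth (s : Fin 3) (hs : s ∈ ({0, 1} : Set (Fin 3))) : T.form v (T.root s) = 0 := by
    have hneg (y : Euc 2 × ℝ) : T.form (T.refl s y) (T.root s) = -T.form y (T.root s) := by
      rw [T.form_refl_left, T.refl_root, map_neg]
    rw [hv, map_sum, LinearMap.sum_apply]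
    refine Finset.sum_involution (fun y _ ↦ T.refl s y) (fun y _ ↦ ?_) (fun y _ hy h ↦ hy ?_)
      (fun y hy ↦ ?_) fun y _ ↦ T.refl_refl s y
    · simp [hneg]
    · have := hneg y
      rw [h] at this
      simp [show T.form y (T.root s) = 0 by linarith]
    · exact hfin.mem_toFinset.2
        (UnitRoots.apply_mem_orbit (UnitRoots.refl_mem_parabolic hs) (hfin.mem_toFinset.1 hy))
  have hsnd : v.2 = T.vertex.2 := by
    rw [hv, Prod.snd_sum, Finset.sum_congr rfl (g := fun _ ↦ (1 / (Y.card : ℝ)) • T.vertex.2)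
      fun y hy ↦ by rw [Prod.smul_snd, T.snd_of_mem_vertices (hfin.mem_toFinset.1 hy)],
      Finset.sum_const, nsmul_eq_mul, smul_eq_mul]
    field_simp
  have h := T.eq_combo v
  rw [horth 0 (by simp), horth 1 (by simp), zero_div, zero_div, zero_smul, zero_smul, zero_add,
    zero_add] at h
  have h2 := congrArg Prod.snd h
  rw [hsnd, Prod.smul_snd, smul_eq_mul, mul_one] at h2
  rwa [h2, ← h]

lemma face_center : T.face (0, 1) = convexHull ℝ T.vertices := by
  refine Subset.antisymm (fun z hz ↦ ?_) (convexHull_min T.vertices_subset_face (T.convex_face _))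
  obtain ⟨x, hx, h0, h1⟩ :=
    UnitRoots.exists_mem_parabolic_form_nonneg T.two_le_left T.form_zero_one z
  have hX := T.form_vertex_zero
  have hκ := T.form_center_two
  have hcos := cos_pi_div_pos T.three_le_left
  have hh := T.vertex_snd_pos
  have hxz := T.apply_mem_face (UnitRoots.parabolic_mono (subset_univ _) hx) hz
  rw [T.apply_center hx] at hxz
  have hsnd : (x z).2 = T.vertex.2 := by
    have := hxz.1
    rw [T.form_center] at this
    linarith
  have h2 : 0 ≤ T.form (x z) (T.root 2) := by
    have := hxz.2 (T.refl 2 (0, 1))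
      (T.apply_mem_centers (UnitRoots.refl_mem_parabolic (mem_univ _)) T.center_mem_centers)
    rw [T.refl_apply, map_sub, map_smul, smul_eq_mul, T.form_center, hsnd] at this
    nlinarith
  suffices hmem : x z ∈ convexHull ℝ T.vertices by
    have him : x⁻¹ (x z) ∈ (x⁻¹).toLinearMap '' convexHull ℝ T.vertices := ⟨_, hmem, rfl⟩
    rw [LinearMap.image_convexHull] at him
    have hz' : x⁻¹ (x z) = z := by simp
    rw [hz'] at him
    refine convexHull_mono ?_ him
    rintro _ ⟨v, hv, rfl⟩
    exact UnitRoots.apply_mem_orbit (inv_mem hx) hv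
  have hmc := T.eq_combo (x z)
  set α := T.form (x z) (T.root 0) / T.form T.vertex (T.root 0)
  set β := T.form (x z) (T.root 1) / (2 * T.form T.vertex (T.root 0) * Real.cos (Real.pi / p))
  set γ := T.form (x z) (T.root 2) / T.form (0, 1) (T.root 2)
  have hα : 0 ≤ α := by positivity
  have hβ : 0 ≤ β := by positivity
  have hγ : 0 ≤ γ := by positivity
  have hsum : α + 2 * β + γ / T.vertex.2 = 1 := by
    have := congrArg Prod.snd hmc
    simp only [Prod.snd_add, Prod.smul_snd, smul_eq_mul, T.snd_refl_zero, hsnd] at this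
    field_simp
    linarith
  have hX0 := subset_convexHull ℝ _ T.vertex_mem_vertices
  have hX1 : T.refl 0 T.vertex ∈ convexHull ℝ T.vertices := subset_convexHull ℝ _
    (UnitRoots.apply_mem_orbit (UnitRoots.refl_mem_parabolic (by simp)) T.vertex_mem_vertices)
  have := (convex_convexHull ℝ T.vertices).sum_mem (t := Finset.univ)
    (w := ![α + β, β, γ / T.vertex.2])
    (z := ![T.vertex, T.refl 0 T.vertex, T.vertex.2 • (0, 1)])
    (fun i _ ↦ by fin_cases i <;> simp <;> positivity)
    (by simp [Fin.sum_univ_three]; linarith)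
    (fun i _ ↦ by fin_cases i; exacts [hX0, hX1, T.smul_center_mem])
  convert this using 1
  rw [hmc, Fin.sum_univ_three]
  simp only [Matrix.cons_val, smul_smul, div_mul_cancel₀ _ hh.ne']
  module

lemma extremePoints_face_center : extremePoints ℝ (T.face (0, 1)) = T.vertices := by
  refine Subset.antisymm ?_ fun v hv ↦ ?_
  · rw [face_center]
    exact extremePoints_convexHull_subset
  have hsnd {w : Euc 2 × ℝ} (hw : w ∈ T.face (0, 1)) : w.2 = T.vertex.2 := by
    have := hw.1
    rw [T.form_center] at this
    linarith
  have hnorm {w : Euc 2 × ℝ} (hw : w ∈ T.vertices) : ‖w.1‖ = ‖T.vertex.1‖ := by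
    have h2 := T.snd_of_mem_vertices hw
    obtain ⟨g, hg, rfl⟩ := hw
    have := UnitRoots.form_apply hg T.vertex T.vertex
    rw [T.form_eq, T.form_eq, real_inner_self_eq_norm_sq, real_inner_self_eq_norm_sq] at this
    simp only at h2
    rw [h2] at this
    exact (pow_left_inj₀ (norm_nonneg _) (norm_nonneg _) two_ne_zero).1 (by linarith)
  have hball {w : Euc 2 × ℝ} (hw : w ∈ T.face (0, 1)) :
      w.1 ∈ Metric.closedBall 0 ‖T.vertex.1‖ := by
    rw [face_center] at hw
    refine convexHull_min (t := Prod.fst ⁻¹' Metric.closedBall 0 ‖T.vertex.1‖) (fun w hw ↦ ?_)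
      ((convex_closedBall _ _).linear_preimage (LinearMap.fst ℝ (Euc 2) ℝ)) hw
    simp [hnorm hw]
  have hne : ‖T.vertex.1‖ ≠ 0 := fun h0 ↦ by
    have h1 : T.vertex = T.vertex.2 • (0, 1) :=
      Prod.ext (by simp [norm_eq_zero.1 h0]) (by simp)
    have h2 := T.form_vertex_zero
    rw [h1, map_smul, LinearMap.smul_apply, T.form_center_zero, smul_zero] at h2
    exact h2.false
  have hext : v.1 ∈ extremePoints ℝ (Metric.closedBall (0 : Euc 2) ‖T.vertex.1‖) :=
    StrictConvexSpace.sphere_subset_extremePoints_closedBall _ hne (by simp [hnorm hv])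
  refine ⟨T.vertices_subset_face hv, fun a ha b hb hab ↦ ?_⟩
  refine Prod.ext (hext.2 (hball ha) (hball hb) ?_) ?_
  · obtain ⟨s, t, hs, ht, hst, rfl⟩ := hab
    exact ⟨s, t, hs, ht, hst, rfl⟩
  · rw [hsnd ha, T.snd_of_mem_vertices hv]

lemma extremePoints_tile {g : (Euc 2 × ℝ) ≃ₗ[ℝ] Euc 2 × ℝ} (hg : g ∈ T.parabolic univ) :
    extremePoints ℝ (T.tile (g (0, 1))) = (fun v ↦ (g v).1) '' T.vertices := by
  set f : (Euc 2 × ℝ) →ₗ[ℝ] Euc 2 := LinearMap.fst ℝ _ _ ∘ₗ g.toLinearMap with hf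
  have hfv (v : Euc 2 × ℝ) : f v = (g v).1 := rfl
  have hinj : InjOn f (T.face (0, 1)) := T.injOn_face hg T.center_mem_centers
  have htile : T.tile (g (0, 1)) = f '' T.face (0, 1) := T.tile_apply hg T.center_mem_centers
  change _ = f '' T.vertices
  rw [htile]
  refine Subset.antisymm ?_ ?_
  · rw [face_center, LinearMap.image_convexHull]
    exact extremePoints_convexHull_subset
  · rintro _ ⟨v, hv, rfl⟩
    refine ⟨mem_image_of_mem _ (T.vertices_subset_face hv), ?_⟩
    rintro _ ⟨a, ha, rfl⟩ _ ⟨b, hb, rfl⟩ ⟨s, t, hs, ht, hst, h⟩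
    rw [← T.extremePoints_face_center] at hv
    rw [← map_smul, ← map_smul, ← map_add] at h
    rw [hv.2 ha hb ⟨s, t, hs, ht, hst, hinj (T.convex_face _ ha hb hs.le ht.le hst) hv.1 h⟩]

lemma ncard_extremePoints_tile {c : Euc 2 × ℝ} (hc : c ∈ T.centers) :
    (extremePoints ℝ (T.tile c)).ncard = p := by
  obtain ⟨g, hg, rfl⟩ := hc
  rw [T.extremePoints_tile hg, InjOn.ncard_image, T.ncard_vertices]
  exact (T.injOn_face hg T.center_mem_centers).mono T.vertices_subset_face

lemma zero_mem_interior_tile : (0 : Euc 2) ∈ interior (T.tile (0, 1)) := by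
  have hδ := T.gap_pos
  have hh := T.vertex_snd_pos
  have hr : 0 < T.vertex.2 * T.gap / (1 + T.gap) := by positivity
  refine mem_interior.2 ⟨_, fun y hy c hc ↦ ?_, Metric.isOpen_ball, Metric.mem_ball_self hr⟩
  by_cases hne : c = (0, 1)
  · rw [hne]
  rw [mem_ball_zero_iff, lt_div_iff₀ (by positivity)] at hy
  have hw := T.snd_pos hc
  have hgap := T.one_add_gap_le_snd hc hne
  have hin : inner ℝ c.1 y ≤ c.2 * ‖y‖ := (real_inner_le_norm _ _).trans
    (mul_le_mul_of_nonneg_right (T.isEnvelope.norm_le c hc) (norm_nonneg _))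
  have h0 : height T.vertex.2 (0, 1) y = T.vertex.2 := by simp [height]
  rw [h0, height, div_le_iff₀ hw]
  have key : (1 + T.gap) * (c.2 * ‖y‖) ≤ (1 + T.gap) * (T.vertex.2 * c.2 - T.vertex.2) := by
    nlinarith [mul_le_mul_of_nonneg_left hy.le hw.le, mul_le_mul_of_nonneg_left hgap hh.le]
  linarith [le_of_mul_le_mul_left key (by positivity)]

lemma interior_tile_nonempty {c : Euc 2 × ℝ} (hc : c ∈ T.centers) :
    (interior (T.tile c)).Nonempty := by
  obtain ⟨g, hg, rfl⟩ := hc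
  have hgc := T.apply_mem_centers hg T.center_mem_centers
  set c := g (0, 1) with hc
  set ψ : Euc 2 → Euc 2 := fun y ↦ (g⁻¹ (y, height T.vertex.2 c y)).1 with hψ
  have hcont : Continuous ψ := by
    have h1 := (g⁻¹).toLinearMap.continuous_of_finiteDimensional
    have h2 := continuous_height T.vertex.2 c
    exact continuous_fst.comp (h1.comp (continuous_id.prodMk h2))
  have hψ_mem (y : Euc 2) (hy : ψ y ∈ T.tile (0, 1)) : y ∈ T.tile c := by
    have hface : g⁻¹ (y, height T.vertex.2 c y) ∈ T.face (0, 1) := by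
      refine (T.mem_face T.center_mem_centers).2 ⟨?_, hy⟩
      rw [← T.form_eq_neg_iff T.center_mem_centers, UnitRoots.form_inv_left hg,
        T.form_eq_neg_iff hgc]
    have := T.apply_mem_face hg hface
    rw [← hc, ← LinearEquiv.mul_apply, mul_inv_cancel] at this
    exact ((T.mem_face hgc).1 this).2
  refine ⟨(g (0, T.vertex.2)).1, mem_interior.2
    ⟨ψ ⁻¹' interior (T.tile (0, 1)), fun y hy ↦ hψ_mem y (interior_subset hy),
      isOpen_interior.preimage hcont, ?_⟩⟩
  have hh : (g (0, T.vertex.2)).2 = height T.vertex.2 c (g (0, T.vertex.2)).1 := by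
    rw [← T.form_eq_neg_iff hgc, hc, UnitRoots.form_apply hg, T.form_center]
  have h0 : ψ (g (0, T.vertex.2)).1 = 0 := by
    simp only [hψ]
    rw [← hh, Prod.mk.eta, ← LinearEquiv.mul_apply, inv_mul_cancel]
    rfl
  rw [mem_preimage, h0]
  exact T.zero_mem_interior_tile

lemma isConvexPolytope_tile {c : Euc 2 × ℝ} (hc : c ∈ T.centers) :
    IsConvexPolytope (T.tile c) := by
  refine ⟨?_, T.interior_tile_nonempty hc⟩
  obtain ⟨g, hg, rfl⟩ := hc
  refine ⟨(T.finite_vertices.image (LinearMap.fst ℝ _ _ ∘ₗ g.toLinearMap)).toFinset, ?_⟩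
  rw [Finite.coe_toFinset, ← LinearMap.image_convexHull, ← face_center]
  exact T.tile_apply hg T.center_mem_centers

lemma injOn_tile : InjOn T.tile T.centers := fun c hc c' hc' h ↦ by
  refine eq_of_interior_cell_inter_nonempty T.vertex_snd_pos (fun _ ↦ T.snd_pos) hc hc' ?_
  change (interior (T.tile c) ∩ interior (T.tile c')).Nonempty
  rw [← h, inter_self]
  exact T.interior_tile_nonempty hc

lemma ncard_tile_extremePoints {x : Euc 2} {c : Euc 2 × ℝ} (hc : c ∈ T.centers)
    (hx : x ∈ extremePoints ℝ (T.tile c)) :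
    {S | S ∈ T.tile '' T.centers ∧ x ∈ extremePoints ℝ S}.ncard = q := by
  obtain ⟨g₁, hg₁, rfl⟩ := hc
  simp only at hx
  have hxc := hx.1
  rw [T.extremePoints_tile hg₁] at hx
  obtain ⟨_, ⟨w₁, hw₁, rfl⟩, rfl⟩ := hx
  have hw₁' := UnitRoots.parabolic_mono (subset_univ _) hw₁
  have hsub : {s | T.form T.vertex (T.root s) = 0} ⊆ {2, 1} := fun s hs ↦ by
    fin_cases s
    exacts [absurd hs T.form_vertex_zero.ne', .inr rfl, .inl rfl]
  obtain ⟨g, hgdef⟩ : ∃ g, g = g₁ * w₁ := ⟨_, rfl⟩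
  have hg : g ∈ T.parabolic univ := hgdef ▸ mul_mem hg₁ hw₁'
  have hlift {g₂ w₂ : (Euc 2 × ℝ) ≃ₗ[ℝ] Euc 2 × ℝ} (hg₂ : g₂ ∈ T.parabolic univ)
      (hw₂ : w₂ ∈ T.parabolic {0, 1}) : g₂ (w₂ T.vertex) ∈ T.face (g₂ (0, 1)) :=
    T.apply_mem_face hg₂ (T.vertices_subset_face ⟨w₂, hw₂, rfl⟩)
  have hset : {c ∈ T.centers | (g₁ (w₁ T.vertex)).1 ∈ extremePoints ℝ (T.tile c)} =
      g '' T.orbit {2, 1} (0, 1) := by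
    ext c
    constructor
    · rintro ⟨⟨g₂, hg₂, rfl⟩, hc⟩
      have hcc := hc.1
      simp only at hc hcc ⊢
      rw [T.extremePoints_tile hg₂] at hc
      obtain ⟨_, ⟨w₂, hw₂, rfl⟩, h⟩ := hc
      have hw₂' := UnitRoots.parabolic_mono (subset_univ _) hw₂
      simp only at h
      have hC₁ := T.apply_mem_centers hg₁ T.center_mem_centers
      have hC₂ := T.apply_mem_centers hg₂ T.center_mem_centers
      have heq : g₂ (w₂ T.vertex) = g₁ (w₁ T.vertex) := by
        refine Prod.ext h ?_
        rw [((T.mem_face hC₂).1 (hlift hg₂ hw₂)).1, ((T.mem_face hC₁).1 (hlift hg₁ hw₁)).1, h]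
        exact le_antisymm (hxc _ hC₂) (hcc _ hC₁)
      have hk : g⁻¹ * (g₂ * w₂) ∈ T.parabolic univ := mul_mem (inv_mem hg) (mul_mem hg₂ hw₂')
      have hfix : (g⁻¹ * (g₂ * w₂)) T.vertex = T.vertex := by
        rw [LinearEquiv.mul_apply, LinearEquiv.mul_apply, heq, hgdef, ← LinearEquiv.mul_apply g₁,
          ← LinearEquiv.mul_apply, inv_mul_cancel]
        rfl
      obtain ⟨n, hn⟩ := hk
      obtain ⟨k, hk⟩ := UnitRoots.exists_isWord_of_apply_eq_self T.isCoxeter T.vertex_mem_chamber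
        hn hfix
      refine ⟨_, ⟨_, ⟨k, hk.mono hsub⟩, rfl⟩, ?_⟩
      simp only
      rw [← LinearEquiv.mul_apply, mul_inv_cancel_left, LinearEquiv.mul_apply, T.apply_center hw₂]
    · rintro ⟨_, ⟨k, hk, rfl⟩, rfl⟩
      have hgk : g * k ∈ T.parabolic univ :=
        mul_mem hg (UnitRoots.parabolic_mono (subset_univ _) hk)
      refine ⟨T.apply_mem_centers hgk T.center_mem_centers, ?_⟩
      have hkX : k T.vertex = T.vertex := UnitRoots.apply_eq_self hk fun s hs ↦ by
        obtain rfl | rfl := hs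
        exacts [T.form_vertex_two, T.form_vertex_one]
      change _ ∈ extremePoints ℝ (T.tile ((g * k) (0, 1)))
      rw [T.extremePoints_tile hgk]
      refine ⟨_, T.vertex_mem_vertices, ?_⟩
      simp only [LinearEquiv.mul_apply, hkX, hgdef]
  have himage : {S | S ∈ T.tile '' T.centers ∧ (g₁ (w₁ T.vertex)).1 ∈ extremePoints ℝ S} =
      T.tile '' {c ∈ T.centers | (g₁ (w₁ T.vertex)).1 ∈ extremePoints ℝ (T.tile c)} := by
    ext S
    constructor
    · rintro ⟨⟨c, hc, rfl⟩, h⟩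
      exact ⟨c, ⟨hc, h⟩, rfl⟩
    · rintro ⟨c, ⟨hc, h⟩, rfl⟩
      exact ⟨⟨c, hc, rfl⟩, h⟩
  simp only
  rw [himage, (T.injOn_tile.mono fun c hc ↦ hc.1).ncard_image, hset,
    ncard_image_of_injective _ g.injective]
  exact UnitRoots.ncard_orbit (by linarith [T.three_le_right]) ((T.symm _ _).trans T.form_one_two)
    T.form_center_two.ne' T.form_center_one

end HyperbolicTriangle

/-- every regular hyperbolic tessellation `{p,q}` is realized by a
tiling of the Euclidean plane by convex `p`-gons, `q` meeting at each vertex. -/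
theorem hyperbolic_tessellation_realized (p q : ℕ) (hp : 3 ≤ p) (hq : 3 ≤ q)
    (hpq : 4 < (p - 2) * (q - 2)) :
    ∃ 𝒯 : Set (Set (Euc 2)), IsTiling 𝒯 ∧ LocallyFiniteTiling 𝒯 ∧ FaceToFace 𝒯 ∧
      (∀ T ∈ 𝒯, IsConvexPolytope T ∧ (Set.extremePoints ℝ T).ncard = p) ∧
      ∀ x : Euc 2, (∃ T ∈ 𝒯, x ∈ Set.extremePoints ℝ T) →
        {T | T ∈ 𝒯 ∧ x ∈ Set.extremePoints ℝ T}.ncard = q := by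
  obtain ⟨T⟩ := nonempty_hyperbolicTriangle hp hq hpq
  refine ⟨T.tile '' T.centers, T.isEnvelope.isTiling, T.isEnvelope.locallyFiniteTiling,
    faceToFace_cell_image _ _, ?_, ?_⟩
  · rintro _ ⟨c, hc, rfl⟩
    exact ⟨T.isConvexPolytope_tile hc, T.ncard_extremePoints_tile hc⟩
  · rintro x ⟨_, ⟨c, hc, rfl⟩, hx⟩
    exact T.ncard_tile_extremePoints hc hx
end
end

section
/- (Hajós' theorem, settling Minkowski's conjecture.) Let d ≥ 1 and let L be an additive subgroup of ℝ^d generated by d linearly independent vectors, such that the translates {l + [0,1]^d : l ∈ L} of the unit cube form a tiling of ℝ^d (they cover ℝ^d and their interiors are pairwise disjoint). Then L contains some standard basis vector e_i; equivalently, every lattice tiling of ℝ^d by unit cubes contains a pair of cubes sharing a complete (d−1)-dimensional face. -/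
open Set

noncomputable section

/-- The unit cube `[0,1]^d`. -/
def unitCube (d : ℕ) : Set (Euc d) := {x | ∀ i, x i ∈ Set.Icc (0 : ℝ) 1}

/-! ### Irredundant covers of cosets in abelian groups -/

section Covers

variable {G ι : Type*} [AddCommGroup G]

/-- The number of prime factors, with multiplicity, of the index of `A` in `B`. -/
def indexLength (A B : AddSubgroup G) : ℕ :=
  ArithmeticFunction.cardFactors (A.relIndex B)

theorem indexLength_add {A B C : AddSubgroup G} [hA : A.FiniteIndex] (hAB : A ≤ B) (hBC : B ≤ C) :
    indexLength A C = indexLength A B + indexLength B C := by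
  have hB := AddSubgroup.finiteIndex_of_le hAB
  rw [indexLength, ← AddSubgroup.relIndex_mul_relIndex A B C hAB hBC,
    ArithmeticFunction.cardFactors_mul AddSubgroup.isFiniteRelIndex_of_finiteIndex.relIndex_ne_zero
      AddSubgroup.isFiniteRelIndex_of_finiteIndex.relIndex_ne_zero]
  rfl

theorem indexLength_inf_right (A B : AddSubgroup G) : indexLength (A ⊓ B) B = indexLength A B := by
  rw [indexLength, AddSubgroup.inf_relIndex_right, indexLength]

theorem indexLength_anti {A B C : AddSubgroup G} [hA : A.FiniteIndex] (hAB : A ≤ B) :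
    indexLength B C ≤ indexLength A C := by
  have h0 : A.relIndex C ≠ 0 := AddSubgroup.isFiniteRelIndex_of_finiteIndex.relIndex_ne_zero
  obtain ⟨k, hk⟩ := AddSubgroup.relIndex_dvd_of_le_left C hAB
  rw [hk] at h0
  rw [indexLength, indexLength, hk, ArithmeticFunction.cardFactors_mul (left_ne_zero_of_mul h0)
    (right_ne_zero_of_mul h0)]
  exact Nat.le_add_right _ _

theorem indexLength_eq_zero {A B : AddSubgroup G} (h : B ≤ A) : indexLength A B = 0 := by
  rw [indexLength, AddSubgroup.relIndex_eq_one.2 h, ArithmeticFunction.cardFactors_one]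

theorem relIndex_lt_of_lt {N A B : AddSubgroup G} [N.FiniteIndex] (hNA : N ≤ A) (hAB : A < B) :
    N.relIndex A < N.relIndex B := by
  have := AddSubgroup.finiteIndex_of_le hNA
  rw [← AddSubgroup.relIndex_mul_relIndex N A B hNA hAB.le]
  have h1 : A.relIndex B ≠ 1 := fun h => hAB.not_ge (AddSubgroup.relIndex_eq_one.1 h)
  have h0 : A.relIndex B ≠ 0 := AddSubgroup.isFiniteRelIndex_of_finiteIndex.relIndex_ne_zero
  have hN : N.relIndex A ≠ 0 := AddSubgroup.isFiniteRelIndex_of_finiteIndex.relIndex_ne_zero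
  exact lt_mul_of_one_lt_right (by omega) (by omega)

theorem prime_index_of_isCoatom {Q : AddSubgroup G} [Q.FiniteIndex] (hQ : IsCoatom Q) :
    Q.index.Prime := by
  have hne : Nontrivial (G ⧸ Q) := by
    rw [← not_subsingleton_iff_nontrivial]
    intro h
    refine hQ.1 (AddSubgroup.index_eq_one.1 ?_)
    exact Nat.card_unique
  have hsimple : IsSimpleAddGroup (G ⧸ Q) := by
    refine ⟨fun S _ => ?_⟩
    have hle : Q ≤ S.comap (QuotientAddGroup.mk' Q) := by
      intro x hx
      rw [AddSubgroup.mem_comap, QuotientAddGroup.mk'_apply, (QuotientAddGroup.eq_zero_iff x).2 hx]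
      exact zero_mem S
    have hsurj := QuotientAddGroup.mk'_surjective Q
    rcases hQ.le_iff.1 hle with h | h
    · right
      rw [← AddSubgroup.map_comap_eq_self_of_surjective hsurj S, h,
        AddSubgroup.map_top_of_surjective _ hsurj]
    · left
      rw [← AddSubgroup.map_comap_eq_self_of_surjective hsurj S, h, QuotientAddGroup.map_mk'_self]
  exact IsSimpleAddGroup.prime_card

/-- A proper subgroup of finite index lies in a subgroup of prime index. -/
theorem exists_le_relIndex_prime {A M : AddSubgroup G} [A.FiniteIndex] (hAM : A < M) :
    ∃ M', A ≤ M' ∧ M' ≤ M ∧ (M'.relIndex M).Prime := by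
  have hfin : Finite (M ⧸ A.addSubgroupOf M) := inferInstance
  have hne : Nontrivial (M ⧸ A.addSubgroupOf M) := by
    rw [← not_subsingleton_iff_nontrivial]
    intro h
    refine hAM.not_ge (AddSubgroup.relIndex_eq_one.1 ?_)
    exact Nat.card_unique
  obtain ⟨Q, hQ, -⟩ := (eq_top_or_exists_le_coatom
    (⊥ : AddSubgroup (M ⧸ A.addSubgroupOf M))).resolve_left bot_ne_top
  have hp := prime_index_of_isCoatom hQ
  refine ⟨(Q.comap (QuotientAddGroup.mk' _)).map M.subtype, ?_, ?_, ?_⟩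
  · intro x hx
    refine ⟨⟨x, hAM.le hx⟩, ?_, rfl⟩
    rw [SetLike.mem_coe, AddSubgroup.mem_comap, QuotientAddGroup.mk'_apply,
      (QuotientAddGroup.eq_zero_iff _).2 (AddSubgroup.mem_addSubgroupOf.2 hx)]
    exact zero_mem Q
  · exact AddSubgroup.map_subtype_le _
  · rw [AddSubgroup.relIndex, AddSubgroup.addSubgroupOf,
      AddSubgroup.comap_map_eq_self_of_injective (AddSubgroup.subtype_injective M),
      AddSubgroup.index_comap_of_surjective _ (QuotientAddGroup.mk'_surjective _)]
    exact hp

/-- A set `X`, invariant under `K`, such that every coset of a subgroup `M` not contained in `K`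
contains a coset, disjoint from `X`, of some subgroup of prime index in `M`. All subgroups are
taken to contain `N`. -/
structure IsPiece (N : AddSubgroup G) (X : Set G) (K : AddSubgroup G) : Prop where
  le : N ≤ K
  add_mem : ∀ x ∈ X, ∀ k ∈ K, x + k ∈ X
  exists_avoid : ∀ M, N ≤ M → ¬ M ≤ K → ∀ y, ∃ M', N ≤ M' ∧ M' ≤ M ∧ (M'.relIndex M).Prime ∧
    ∃ z, z - y ∈ M ∧ ∀ m ∈ M', z + m ∉ X

/-- The sets `X i`, `i ∈ F`, cover the coset `y + M`. -/
def CoversCoset (X : ι → Set G) (y : G) (M : AddSubgroup G) (F : Finset ι) : Prop :=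
  ∀ m ∈ M, ∃ i ∈ F, y + m ∈ X i

variable {N : AddSubgroup G} {X : ι → Set G} {K : ι → AddSubgroup G}

theorem le_finset_inf (hX : ∀ i, IsPiece N (X i) (K i)) (F : Finset ι) : N ≤ F.inf K :=
  Finset.le_inf fun i _ => (hX i).le

theorem CoversCoset.exists_minimal {y : G} {M : AddSubgroup G} {F : Finset ι}
    (h : CoversCoset X y M F) : ∃ F' ⊆ F, Minimal (CoversCoset X y M) F' :=
  exists_minimal_le_of_wellFoundedLT _ _ h

theorem CoversCoset.sdiff [DecidableEq ι] (hX : ∀ i, IsPiece N (X i) (K i)) {x : G}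
    {M : AddSubgroup G} {F S : Finset ι} (hM : M ≤ S.inf K) (hF : CoversCoset X x M F)
    (hS : ∀ i ∈ S, x ∉ X i) : CoversCoset X x M (F \ S) := by
  intro m hm
  obtain ⟨i, hi, hxi⟩ := hF m hm
  refine ⟨i, Finset.mem_sdiff.2 ⟨hi, fun hiS => hS i hiS ?_⟩, hxi⟩
  have := (hX i).add_mem _ hxi (-m) (neg_mem ((Finset.inf_le hiS : S.inf K ≤ K i) (hM hm)))
  simpa using this

theorem CoversCoset.translate {y x : G} {M W : AddSubgroup G} {F : Finset ι}
    (h : CoversCoset X y M F) (hx : x - y ∈ M) (hW : W ≤ M) : CoversCoset X x W F := by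
  intro m hm
  have := h ((x - y) + m) (add_mem hx (hW hm))
  rwa [← add_assoc, add_sub_cancel] at this

/-- Completing a proper subfamily `S` of an irredundant cover: the remaining sets account for
the index of the common stabilizer in that of `S`. -/
theorem indexLength_lt_card_sdiff [DecidableEq ι] [N.FiniteIndex]
    (hX : ∀ i, IsPiece N (X i) (K i)) {M : AddSubgroup G} (hNM : N ≤ M)
    (ih : ∀ W, N ≤ W → W < M → ∀ (y : G) (F : Finset ι), Minimal (CoversCoset X y W) F →
      indexLength (F.inf K) W < F.card)
    {y : G} {F : Finset ι} (hF : Minimal (CoversCoset X y M) F) (n : ℕ) :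
    ∀ S : Finset ι, S ⊂ F → ¬ M ≤ S.inf K → (F \ S).card = n →
      indexLength (F.inf K) (M ⊓ S.inf K) < (F \ S).card := by
  induction n using Nat.strong_induction_on with
  | _ n IH =>
    intro S hSF hMS hn
    have hnot : ¬ CoversCoset X y M S := hF.not_prop_of_lt hSF
    simp only [CoversCoset, not_forall, not_exists, not_and] at hnot
    obtain ⟨m, hm, hmS⟩ := hnot
    set W := M ⊓ S.inf K with hW
    have hNW : N ≤ W := le_inf hNM (le_finset_inf hX S)
    have hcov : CoversCoset X (y + m) W (F \ S) :=
      (hF.prop.translate (by simpa using hm) inf_le_left).sdiff hX inf_le_right hmS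
    obtain ⟨T, hTF, hT⟩ := hcov.exists_minimal
    have hlt : W < M := inf_le_left.lt_of_ne fun h => hMS (inf_eq_left.1 h)
    have h1 := ih W hNW hlt _ _ hT
    have hdisj : Disjoint S T := Finset.disjoint_of_subset_right hTF Finset.disjoint_sdiff
    have hTcard : 0 < T.card := (Nat.zero_le _).trans_lt h1
    have hunion : S ∪ T ⊆ F := Finset.union_subset hSF.1 (hTF.trans Finset.sdiff_subset)
    have hsplit : (F \ S).card = (F \ (S ∪ T)).card + T.card := by
      rw [← Finset.card_sdiff_add_card_eq_card hTF, sdiff_sdiff_left]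
      rfl
    have hW' : M ⊓ (S ∪ T).inf K = W ⊓ T.inf K := by
      rw [Finset.inf_union, hW, inf_assoc]
    have h2 : indexLength (F.inf K) (M ⊓ (S ∪ T).inf K) ≤ (F \ (S ∪ T)).card := by
      rcases hunion.eq_or_ssubset with h | h
      · rw [h, indexLength_eq_zero inf_le_right]; exact Nat.zero_le _
      · refine (IH _ (by omega) (S ∪ T) h (fun h' => hMS (h'.trans ?_)) rfl).le
        exact Finset.inf_mono Finset.subset_union_left
    have : (F.inf K ⊓ W).FiniteIndex :=
      AddSubgroup.finiteIndex_of_le (le_inf (le_finset_inf hX F) hNW)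
    have hle : F.inf K ⊓ W ≤ W ⊓ T.inf K :=
      le_inf inf_le_right (inf_le_left.trans
        (Finset.inf_mono (hTF.trans Finset.sdiff_subset)))
    have key := indexLength_add hle inf_le_left
    rw [indexLength_inf_right] at key
    have e1 : indexLength (W ⊓ T.inf K) W = indexLength (T.inf K) W := by
      rw [inf_comm, indexLength_inf_right]
    have e2 : indexLength (F.inf K ⊓ W) (W ⊓ T.inf K)
        = indexLength (F.inf K) (M ⊓ (S ∪ T).inf K) := by
      rw [hW', ← indexLength_inf_right (F.inf K) (W ⊓ T.inf K)]
      congr 1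
      exact le_antisymm (le_inf inf_le_left hle) (inf_le_inf_left _ inf_le_left)
    omega

/-- An irredundant cover of a coset of `M` by pieces has more members than the number of prime
factors of the index in `M` of their common stabilizer. -/
theorem indexLength_lt_card [N.FiniteIndex] (hX : ∀ i, IsPiece N (X i) (K i)) (n : ℕ) :
    ∀ M, N ≤ M → N.relIndex M = n → ∀ (y : G) (F : Finset ι), Minimal (CoversCoset X y M) F →
      indexLength (F.inf K) M < F.card := by
  classical
  induction n using Nat.strong_induction_on with
  | _ n IH =>
    intro M hNM hn y F hF
    have ih : ∀ W, N ≤ W → W < M → ∀ (y : G) (F : Finset ι), Minimal (CoversCoset X y W) F →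
        indexLength (F.inf K) W < F.card := fun W hNW hWM =>
      IH _ (hn ▸ relIndex_lt_of_lt hNW hWM) W hNW rfl
    by_cases hMF : M ≤ F.inf K
    · rw [indexLength_eq_zero hMF, Finset.card_pos]
      obtain ⟨i, hi, -⟩ := hF.prop 0 (zero_mem M)
      exact ⟨i, hi⟩
    simp only [Finset.le_inf_iff, not_forall] at hMF
    obtain ⟨j, hj, hMj⟩ := hMF
    obtain ⟨M', hNM', hM'M, hprime, z, hz, havoid⟩ := (hX j).exists_avoid M hNM hMj y
    have hlt : M' < M := hM'M.lt_of_ne fun h => by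
      rw [h, AddSubgroup.relIndex_self] at hprime
      exact Nat.not_prime_one hprime
    have hcov : CoversCoset X z M' (F.erase j) := by
      intro m hm
      obtain ⟨i, hi, hxi⟩ := hF.prop.translate hz hM'M m hm
      exact ⟨i, Finset.mem_erase.2 ⟨fun h => havoid m hm (h ▸ hxi), hi⟩, hxi⟩
    obtain ⟨S, hSF, hS⟩ := hcov.exists_minimal
    have h1 := ih M' hNM' hlt z S hS
    have hSF' : S ⊂ F := lt_of_le_of_lt hSF (Finset.erase_ssubset hj)
    have hMS : ¬ M ≤ S.inf K := by
      intro hMS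
      obtain ⟨i, hi, hzi⟩ := hS.prop 0 (zero_mem M')
      refine hF.not_prop_of_lt hSF' fun m hm => ⟨i, hi, ?_⟩
      have := (hX i).add_mem _ hzi (m - (z - y))
        ((Finset.inf_le hi : S.inf K ≤ K i) (hMS (sub_mem hm hz)))
      convert this using 1
      abel
    have h2 := indexLength_lt_card_sdiff hX hNM ih hF _ S hSF' hMS rfl
    have hcard := Finset.card_sdiff_add_card_eq_card hSF'.1
    have : (S.inf K).FiniteIndex := AddSubgroup.finiteIndex_of_le (le_finset_inf hX S)
    have : M'.FiniteIndex := AddSubgroup.finiteIndex_of_le hNM'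
    have : (F.inf K ⊓ M).FiniteIndex :=
      AddSubgroup.finiteIndex_of_le (le_inf (le_finset_inf hX F) hNM)
    have hFS : F.inf K ≤ S.inf K := Finset.inf_mono hSF'.1
    have e1 : indexLength (F.inf K) M
        = indexLength (F.inf K) (M ⊓ S.inf K) + indexLength (S.inf K) M := by
      rw [← indexLength_inf_right, indexLength_add (B := M ⊓ S.inf K)
        (le_inf inf_le_right (inf_le_left.trans hFS)) inf_le_left, inf_comm M,
        indexLength_inf_right (S.inf K), ← indexLength_inf_right (F.inf K) (S.inf K ⊓ M)]
      congr 2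
      exact le_antisymm (le_inf inf_le_left (le_inf (inf_le_left.trans hFS) inf_le_right))
        (inf_le_inf_left _ inf_le_right)
    have e2 : indexLength (S.inf K) M ≤ indexLength (S.inf K) M' + 1 := by
      refine (indexLength_anti (inf_le_left : S.inf K ⊓ M' ≤ _)).trans ?_
      rw [indexLength_add inf_le_right hM'M, indexLength_inf_right,
        indexLength, indexLength, ArithmeticFunction.cardFactors_apply_prime hprime]
    omega

end Covers


/-! ### Hajós' theorem in finite-index form -/

section Hajos

variable {G ι : Type*} [AddCommGroup G] {N : AddSubgroup G} [N.FiniteIndex]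

theorem isPiece_subgroup {H : AddSubgroup G} (hN : N ≤ H) : IsPiece N (H : Set G) H where
  le := hN
  add_mem _ hx _ hk := H.add_mem hx hk
  exists_avoid M hNM hM y := by
    have hlt : M ⊓ H < M := inf_le_left.lt_of_ne fun h => hM (inf_eq_left.1 h)
    have : (M ⊓ H).FiniteIndex := AddSubgroup.finiteIndex_of_le (le_inf hNM hN)
    obtain ⟨M', h1, h2, h3⟩ := exists_le_relIndex_prime hlt
    have hnot : ¬ M ≤ M' := fun h => by
      rw [AddSubgroup.relIndex_eq_one.2 h] at h3
      exact Nat.not_prime_one h3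
    obtain ⟨w, hwM, hw⟩ := SetLike.not_le_iff_exists.1 hnot
    refine ⟨M', (le_inf hNM hN).trans h1, h2, h3, ?_⟩
    by_cases hy : ∀ m ∈ M', y + m ∉ (H : Set G)
    · exact ⟨y, by simp, hy⟩
    · push Not at hy
      obtain ⟨m, hm, hym⟩ := hy
      refine ⟨y + w, by simpa using hwM, fun m' hm' hmem => hw ?_⟩
      have hH : w + m' - m ∈ H := by
        have := H.sub_mem hmem hym
        convert this using 1
        abel
      have hM' := h1 (AddSubgroup.mem_inf.2 ⟨M.sub_mem (M.add_mem hwM (h2 hm')) (h2 hm), hH⟩)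
      have := add_mem (sub_mem hM' hm') hm
      convert this using 1
      abel

theorem isPiece_diff {H K : AddSubgroup G} (hN : N ≤ K) (hKH : K ≤ H) {q : ℕ} (hq : q.Prime)
    (hdvd : K.relIndex H ∣ q) : IsPiece N ((H : Set G) \ K) K where
  le := hN
  add_mem x hx k hk :=
    ⟨add_mem hx.1 (hKH hk), fun h => hx.2 ((AddSubgroup.add_mem_cancel_right K hk).1 h)⟩
  exists_avoid M hNM hM y := by
    by_cases hMH : M ≤ H
    · have hmul := AddSubgroup.relIndex_mul_relIndex K (M ⊔ K) H le_sup_right (sup_le hMH hKH)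
      rw [AddSubgroup.relIndex_sup_right] at hmul
      have hKM : K.relIndex M = q :=
        (hq.eq_one_or_self_of_dvd _ ((Dvd.intro _ hmul).trans hdvd)).resolve_left
          fun h => hM (AddSubgroup.relIndex_eq_one.1 h)
      rw [hKM] at hmul
      have hsup : H ≤ M ⊔ K := by
        rw [← AddSubgroup.relIndex_eq_one]
        have : q * (M ⊔ K).relIndex H ∣ q * 1 := by rw [hmul, mul_one]; exact hdvd
        exact Nat.dvd_one.1 (Nat.dvd_of_mul_dvd_mul_left hq.pos this)
      refine ⟨K ⊓ M, le_inf hN hNM, inf_le_right, ?_, ?_⟩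
      · rwa [AddSubgroup.inf_relIndex_right, hKM]
      · by_cases hy : y ∈ H
        · obtain ⟨m, hm, k, hk, rfl⟩ := AddSubgroup.mem_sup.1 (hsup hy)
          exact ⟨k, by simpa using hm, fun m' hm' h => h.2 (add_mem hk hm'.1)⟩
        · exact ⟨y, by simp, fun m' hm' h =>
            hy ((AddSubgroup.add_mem_cancel_right H (hMH hm'.2)).1 h.1)⟩
    · obtain ⟨M', h1, h2, h3, z, hz, h4⟩ :=
        (isPiece_subgroup (hN.trans hKH)).exists_avoid M hNM hMH y
      exact ⟨M', h1, h2, h3, z, hz, fun m hm h => h4 m hm h.1⟩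

variable {H K : ι → AddSubgroup G}

theorem isPiece_option_elim (hK : ∀ i, N ≤ K i) (hKH : ∀ i, K i ≤ H i)
    (hrel : ∀ i, ∃ q : ℕ, q.Prime ∧ (K i).relIndex (H i) ∣ q) {A : AddSubgroup G} (hA : N ≤ A)
    (o : Option ι) :
    IsPiece N (o.elim (A : Set G) fun i => (H i : Set G) \ K i) (o.elim A K) := by
  cases o with
  | none => exact isPiece_subgroup hA
  | some i =>
    obtain ⟨q, hq, hdvd⟩ := hrel i
    exact isPiece_diff (hK i) (hKH i) hq hdvd

theorem indexLength_inf_le_card_sdiff [DecidableEq ι] (hK : ∀ i, N ≤ K i)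
    (hKH : ∀ i, K i ≤ H i) (hrel : ∀ i, ∃ q : ℕ, q.Prime ∧ (K i).relIndex (H i) ∣ q)
    {B : AddSubgroup G} (hNB : N ≤ B) {I : Finset ι}
    (hcov : ∀ g ∉ B, ∃ i ∈ I, g ∈ H i ∧ g ∉ K i) (S : Finset ι) :
    indexLength B (S.inf K) ≤ (I \ S).card := by
  have hX := isPiece_option_elim hK hKH hrel hNB
  have hNS : N ≤ S.inf K := Finset.le_inf fun i _ => hK i
  have h0 : CoversCoset (fun o : Option ι => o.elim (B : Set G) fun i => (H i : Set G) \ K i) 0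
      (S.inf K) (I \ S).insertNone := by
    intro m hm
    rw [zero_add]
    by_cases hmB : m ∈ B
    · exact ⟨none, by simp, hmB⟩
    · obtain ⟨i, hi, hiH, hiK⟩ := hcov m hmB
      exact ⟨some i, by simpa using ⟨hi, fun h => hiK ((Finset.inf_le h : S.inf K ≤ K i) hm)⟩,
        hiH, hiK⟩
  obtain ⟨F, hF, hmin⟩ := h0.exists_minimal
  have hnone : none ∈ F := by
    obtain ⟨o, ho, h⟩ := hmin.prop 0 (zero_mem _)
    cases o with
    | none => exact ho
    | some i => exact (h.2 (by simp)).elim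
  have h1 := indexLength_lt_card hX _ _ hNS rfl _ _ hmin
  have h2 := Finset.card_le_card hF
  rw [Finset.card_insertNone] at h2
  have hfin := AddSubgroup.finiteIndex_of_le (le_finset_inf hX F)
  have h3 : indexLength B (S.inf K) ≤ _ :=
    indexLength_anti (Finset.inf_le hnone : F.inf (fun o : Option ι => o.elim B K) ≤ B)
  omega

/-- **Hajós' theorem**, dual form: if the complement of `B` is covered by the differences
`H i \ K i` of subgroups of prime relative index, and there are no more of them than prime factors
of the index of `B`, then some `H i` is the whole group. -/
theorem exists_eq_top_of_cover (hK : ∀ i, N ≤ K i) (hKH : ∀ i, K i ≤ H i)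
    (hrel : ∀ i, ∃ q : ℕ, q.Prime ∧ (K i).relIndex (H i) ∣ q) (n : ℕ) :
    ∀ (B : AddSubgroup G) (I : Finset ι), N ≤ B → I.card = n → I.Nonempty →
      (∀ i ∈ I, B ≤ K i) → (∀ g ∉ B, ∃ i ∈ I, g ∈ H i ∧ g ∉ K i) → n ≤ indexLength B ⊤ →
      ∃ i ∈ I, H i = ⊤ := by
  classical
  induction n using Nat.strong_induction_on with
  | _ n IH =>
    intro B I hNB hcard ⟨i₀, hi₀⟩ hBK hcov hn
    by_cases htop : H i₀ = ⊤
    · exact ⟨i₀, hi₀, htop⟩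
    have hX := isPiece_option_elim hK hKH hrel ((hK i₀).trans (hKH i₀))
    have h0 : CoversCoset
        (fun o : Option ι => o.elim (H i₀ : Set G) fun i => (H i : Set G) \ K i) 0
        ⊤ (I.erase i₀).insertNone := by
      intro m _
      rw [zero_add]
      by_cases hm : m ∈ H i₀
      · exact ⟨none, by simp, hm⟩
      · obtain ⟨i, hi, hiH, hiK⟩ := hcov m fun h => hm (hKH _ (hBK _ hi₀ h))
        exact ⟨some i, by simpa using ⟨fun h => hm (h ▸ hiH), hi⟩, hiH, hiK⟩
    obtain ⟨F, hF, hmin⟩ := h0.exists_minimal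
    have hnone : none ∈ F := by
      obtain ⟨o, ho, h⟩ := hmin.prop 0 (zero_mem _)
      cases o with
      | none => exact ho
      | some i => exact (h.2 (by simp)).elim
    have hlt := indexLength_lt_card hX _ _ le_top rfl _ _ hmin
    set J := F.eraseNone with hJ
    have hFJ : F = J.insertNone := by
      rw [hJ, Finset.insertNone_eraseNone, Finset.insert_eq_of_mem hnone]
    have hJI : J ⊆ I.erase i₀ := fun i hi => by
      simpa using hF (Finset.mem_eraseNone.1 hi)
    have hJI' : J ⊂ I := lt_of_le_of_lt hJI (Finset.erase_ssubset hi₀)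
    have hJne : J.Nonempty := by
      rw [Finset.nonempty_iff_ne_empty]
      intro hJe
      refine htop (eq_top_iff.2 fun g _ => ?_)
      obtain ⟨o, ho, h⟩ := hmin.prop g trivial
      rw [hFJ, hJe] at ho
      cases o with
      | none => simpa using h
      | some i => simp at ho
    have hNJ : N ≤ J.inf K := Finset.le_inf fun i _ => hK i
    have hBJ : B ≤ J.inf K := Finset.le_inf fun i hi => hBK i (hJI'.1 hi)
    have hBfin := AddSubgroup.finiteIndex_of_le hNB
    have hlen : indexLength (J.inf K) ⊤ ≤ J.card := by
      have hfin := AddSubgroup.finiteIndex_of_le (le_finset_inf hX F)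
      have hle : F.inf (fun o : Option ι => o.elim (H i₀) K) ≤ J.inf K :=
        Finset.le_inf fun i hi => Finset.inf_le (f := fun o : Option ι => o.elim (H i₀) K)
          (Finset.mem_eraseNone.1 hi)
      have := indexLength_anti (C := ⊤) hle
      rw [hFJ, Finset.card_insertNone, ← hFJ] at hlt
      omega
    have hadd := indexLength_add hBJ le_top
    have hJcard := Finset.card_sdiff_add_card_eq_card hJI'.1
    have hB : indexLength B (J.inf K) ≤ (I \ J).card :=
      indexLength_inf_le_card_sdiff hK hKH hrel hNB hcov J
    have hX' : ∀ i, IsPiece N ((H i : Set G) \ K i) (K i) :=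
      fun i => isPiece_option_elim hK hKH hrel hNB (some i)
    have hcovJ : ∀ g ∉ J.inf K, ∃ i ∈ J, g ∈ H i ∧ g ∉ K i := by
      intro g hg
      by_contra hgJ
      have hgI : CoversCoset (fun i => (H i : Set G) \ K i) g (J.inf K) I := by
        intro m hm
        obtain ⟨i, hi, h⟩ := hcov (g + m) fun h =>
          hg ((AddSubgroup.add_mem_cancel_right _ hm).1 (hBJ h))
        exact ⟨i, hi, h⟩
      obtain ⟨T, hTI, hT⟩ := (hgI.sdiff hX' le_rfl
        fun i hi h => hgJ ⟨i, hi, h⟩).exists_minimal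
      have h1 := indexLength_lt_card hX' _ _ hNJ rfl _ _ hT
      have h2 := indexLength_inf_le_card_sdiff hK hKH hrel hNB hcov (T ∪ J)
      have h3 : B ≤ T.inf K ⊓ J.inf K := le_inf
        (Finset.le_inf fun i hi => hBK i (Finset.mem_sdiff.1 (hTI hi)).1) hBJ
      have h4 := indexLength_add h3 inf_le_right
      rw [indexLength_inf_right] at h4
      rw [Finset.inf_union] at h2
      have h5 : (I \ (T ∪ J)).card + T.card = (I \ J).card := by
        rw [← Finset.card_sdiff_add_card_eq_card hTI, sdiff_sdiff_left, Finset.union_comm T J]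
        rfl
      omega
    obtain ⟨i, hi, h⟩ := IH J.card (hcard ▸ Finset.card_lt_card hJI') (J.inf K) J hNJ rfl hJne
      (fun i hi => Finset.inf_le hi) hcovJ (by omega)
    exact ⟨i, hJI'.1 hi, h⟩

end Hajos

/-! ### Hajós' theorem for rational matrices -/

section Rational

theorem index_range_mulVecLin {n : Type*} [Fintype n] [DecidableEq n] (E : Matrix n n ℤ)
    (hE : E.det ≠ 0) : (LinearMap.range E.mulVecLin).toAddSubgroup.index = E.det.natAbs := by
  have hinj : Function.Injective E.mulVecLin := by
    rw [← LinearMap.ker_eq_bot, LinearMap.ker_eq_bot']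
    exact fun m hm => Matrix.eq_zero_of_mulVec_eq_zero hE hm
  have h := Submodule.natAbs_det_equiv (LinearMap.range E.mulVecLin)
    (LinearEquiv.ofInjective E.mulVecLin hinj)
  have h2 : (LinearMap.range E.mulVecLin).subtype ∘ₗ AddMonoidHom.toIntLinearMap
      ((LinearEquiv.ofInjective E.mulVecLin hinj : (n → ℤ) ≃ₗ[ℤ] _) :
        (n → ℤ) →+ LinearMap.range E.mulVecLin) = Matrix.toLin' E := by
    ext; rfl
  rw [h2, LinearMap.det_toLin'] at h
  exact h.symm

theorem exists_int_matrix_eq_smul {n : Type*} [Fintype n] (A : Matrix n n ℚ) :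
    ∃ (D : ℕ) (E : Matrix n n ℤ), 1 < D ∧ ∀ i j, (E i j : ℚ) = D * A i j := by
  obtain ⟨b, hb⟩ := IsLocalization.exist_integer_multiples_of_finite (nonZeroDivisors ℤ)
    (fun p : n × n => A p.1 p.2)
  have hb0 : (b : ℤ) ≠ 0 := nonZeroDivisors.coe_ne_zero b
  choose f hf using hb
  refine ⟨2 * (b : ℤ).natAbs, fun i j => 2 * (b : ℤ).sign * f (i, j), by omega, fun i j => ?_⟩
  have h := hf (i, j)
  simp only [eq_intCast, zsmul_eq_mul] at h
  have hs : (((b : ℤ).natAbs : ℤ) : ℚ) = (((b : ℤ).sign * (b : ℤ) : ℤ) : ℚ) := by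
    rw [Int.sign_mul_self_eq_natAbs]
  have hs' : (((b : ℤ).natAbs : ℕ) : ℚ) = ((b : ℤ).sign : ℚ) * ((b : ℤ) : ℚ) := by
    rw [← Int.cast_mul, ← hs, Int.cast_natCast]
  rw [Int.cast_mul, Int.cast_mul, h, Nat.cast_mul, hs']
  push_cast
  ring

theorem relIndex_comap_zmultiples_dvd {G : Type*} [AddCommGroup G] (g : G →+ ℚ) {c q : ℕ}
    (hc : c ≠ 0) :
    ((AddSubgroup.zmultiples ((c * q : ℕ) : ℚ)).comap g).relIndex
      ((AddSubgroup.zmultiples (c : ℚ)).comap g) ∣ q := by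
  have hle : AddSubgroup.zmultiples ((c * q : ℕ) : ℚ) ≤ AddSubgroup.zmultiples (c : ℚ) := by
    rw [AddSubgroup.zmultiples_le]
    exact AddSubgroup.mem_zmultiples_iff.2 ⟨q, by simp [mul_comm]⟩
  have hq : (AddSubgroup.zmultiples ((c * q : ℕ) : ℚ)).relIndex
      (AddSubgroup.zmultiples (c : ℚ)) = q := by
    have h := AddSubgroup.relIndex_map_map_of_injective (f := zmultiplesHom ℚ (c : ℚ))
      (AddSubgroup.zmultiples (q : ℤ)) ⊤ (fun a b hab => by
        have hc' : (c : ℚ) ≠ 0 := by exact_mod_cast hc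
        simpa [hc'] using hab)
    rw [AddSubgroup.relIndex_top_right, Int.index_zmultiples] at h
    rw [AddMonoidHom.map_zmultiples, ← AddMonoidHom.range_eq_map] at h
    have h2 : (zmultiplesHom ℚ (c : ℚ)).range = AddSubgroup.zmultiples (c : ℚ) := by
      ext x; simp [AddSubgroup.mem_zmultiples_iff]
    rw [h2] at h
    simpa [mul_comm] using h
  rw [AddSubgroup.relIndex_comap, AddSubgroup.map_comap_eq]
  have key : ∀ A B X : AddSubgroup ℚ, A ≤ B → A.relIndex (X ⊓ B) ∣ A.relIndex B := by
    intro A B X hAB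
    rw [← AddSubgroup.relIndex_sup_right, sup_comm,
      ← AddSubgroup.relIndex_mul_relIndex A (A ⊔ X ⊓ B) B le_sup_left (sup_le hAB inf_le_right)]
    exact Dvd.intro _ rfl
  have := key _ _ g.range hle
  rwa [hq] at this

/-- The additive map given by a row of a matrix, restricted to integer vectors. -/
def rowHom {n : Type*} [Fintype n] (C : Matrix n n ℚ) (i : n) : (n → ℤ) →+ ℚ where
  toFun m := ∑ j, C i j * m j
  map_zero' := by simp
  map_add' x y := by simp [mul_add, Finset.sum_add_distrib]

theorem exists_integral_row_rat {n : Type*} [Fintype n] [DecidableEq n] [Nonempty n]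
    (C : Matrix n n ℚ) (hdet : C.det = 1 ∨ C.det = -1)
    (hC : ∀ m : n → ℤ, m ≠ 0 → ∃ i, ∃ z : ℤ, z ≠ 0 ∧ ∑ j, C i j * m j = z) :
    ∃ i, ∀ j, ∃ z : ℤ, C i j = z := by
  have hu : IsUnit C.det := by rcases hdet with h | h <;> simp [h]
  obtain ⟨D, E, hD, hE⟩ := exists_int_matrix_eq_smul C⁻¹
  have hD0 : (D : ℚ) ≠ 0 := by positivity
  have hEmap : E.map (Int.castRingHom ℚ) = (D : ℚ) • C⁻¹ := by ext i j; simp [hE]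
  have hCE : C * E.map (Int.castRingHom ℚ) = (D : ℚ) • 1 := by
    rw [hEmap, Matrix.mul_smul, Matrix.mul_nonsing_inv _ hu]
  have hEC : E.map (Int.castRingHom ℚ) * C = (D : ℚ) • 1 := by
    rw [hEmap, Matrix.smul_mul, Matrix.nonsing_inv_mul _ hu]
  have hdetE : E.det.natAbs = D ^ Fintype.card n := by
    have h1 : ((E.det : ℤ) : ℚ) = D ^ Fintype.card n * C.det⁻¹ := by
      have := congrArg Matrix.det hEmap
      rwa [Matrix.det_smul, Matrix.det_nonsing_inv, Ring.inverse_eq_inv',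
        ← RingHom.mapMatrix_apply, ← RingHom.map_det] at this
    have h2 : E.det = D ^ Fintype.card n ∨ E.det = -(D ^ Fintype.card n) := by
      rcases hdet with h | h
      · left; rw [h] at h1; exact_mod_cast (by simpa using h1 : (E.det : ℚ) = D ^ Fintype.card n)
      · right; rw [h] at h1
        exact_mod_cast (by simpa [inv_neg] using h1 : (E.det : ℚ) = -(D ^ Fintype.card n))
    rcases h2 with h | h <;> simp [h, Int.natAbs_pow]
  have hrow : ∀ (z : n → ℤ) i, rowHom C i (E.mulVecLin z) = D * z i := by
    intro z i
    have h := congrFun (congrArg (fun A => Matrix.mulVec A (fun j => (z j : ℚ))) hCE) i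
    simp only [← Matrix.mulVec_mulVec, Matrix.smul_mulVec, Matrix.one_mulVec, Pi.smul_apply,
      smul_eq_mul] at h
    rw [← h]
    simp [rowHom, Matrix.mulVec, dotProduct]
  have hinj : ∀ m : n → ℤ, (∀ i, rowHom C i m = 0) → m = 0 := by
    intro m hm
    have h1 : C.mulVec (fun j => (m j : ℚ)) = 0 := by
      ext i; exact hm i
    have h2 := Matrix.eq_zero_of_mulVec_eq_zero hu.ne_zero h1
    ext j
    have := congrFun h2 j
    simpa using this
  set N := (LinearMap.range E.mulVecLin).toAddSubgroup with hN
  have hNmem : ∀ m, m ∈ N ↔ ∀ i, rowHom C i m ∈ AddSubgroup.zmultiples (D : ℚ) := by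
    intro m
    constructor
    · rintro ⟨z, rfl⟩ i
      exact AddSubgroup.mem_zmultiples_iff.2 ⟨z i, by rw [hrow]; simp [mul_comm]⟩
    · intro h
      choose z hz using fun i => AddSubgroup.mem_zmultiples_iff.1 (h i)
      refine ⟨z, ?_⟩
      rw [← sub_eq_zero]
      refine hinj _ fun i => ?_
      rw [map_sub, hrow, ← hz]
      simp [mul_comm]
  have hidx : N.index = D ^ Fintype.card n := by
    rw [hN, index_range_mulVecLin E, hdetE]
    intro h0
    rw [h0] at hdetE
    have : 0 < D ^ Fintype.card n := by positivity
    simp at hdetE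
    omega
  have : N.FiniteIndex := ⟨by rw [hidx]; positivity⟩
  set l := D.primeFactorsList with hl
  have hlprod : l.prod = D := Nat.prod_primeFactorsList (by omega)
  set c : ℕ → ℕ := fun k => (l.take k).prod with hcdef
  have hcs : ∀ k (hk : k < l.length), c (k + 1) = c k * l[k] := fun k hk =>
    List.prod_take_succ l k hk
  have hc0 : ∀ k, c k ≠ 0 := fun k => by
    refine List.prod_ne_zero fun h => ?_
    exact Nat.not_prime_zero (Nat.prime_of_mem_primeFactorsList (List.mem_of_mem_take h))
  have hcD : ∀ k, c k ∣ D := fun k => by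
    rw [← hlprod]
    exact ⟨(l.drop k).prod, (List.prod_take_mul_prod_drop l k).symm⟩
  have hdvd : ∀ {a b : ℕ}, a ∣ b →
      AddSubgroup.zmultiples (b : ℚ) ≤ AddSubgroup.zmultiples (a : ℚ) := by
    rintro a _ ⟨q, rfl⟩
    rw [AddSubgroup.zmultiples_le]
    exact AddSubgroup.mem_zmultiples_iff.2 ⟨q, by simp [mul_comm]⟩
  have hlen : 0 < l.length := by
    rw [List.length_pos_iff, hl]
    simp only [ne_eq, Nat.primeFactorsList_eq_nil]
    omega
  obtain ⟨⟨i, k⟩, -, hik⟩ := exists_eq_top_of_cover (N := N) (ι := n × Fin l.length)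
    (H := fun p => (AddSubgroup.zmultiples (c p.2 : ℚ)).comap (rowHom C p.1))
    (K := fun p => (AddSubgroup.zmultiples (c (p.2 + 1) : ℚ)).comap (rowHom C p.1))
    (fun p m hm => hdvd (hcD _) ((hNmem m).1 hm p.1))
    (fun p => AddSubgroup.comap_mono (hdvd ⟨l[p.2], hcs _ _⟩))
    (fun p => ⟨l[p.2], Nat.prime_of_mem_primeFactorsList (List.getElem_mem _), by
      rw [hcs _ p.2.2]
      exact relIndex_comap_zmultiples_dvd _ (hc0 _)⟩)
    (Fintype.card n * l.length) N Finset.univ le_rfl (by simp)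
    ⟨(Classical.arbitrary n, ⟨0, hlen⟩), Finset.mem_univ _⟩
    (fun p _ m hm => hdvd (hcD _) ((hNmem m).1 hm p.1))
    (fun m hm => by
      classical
      have hz : ∀ i, ∃ z : ℤ, rowHom C i m ∈ AddSubgroup.zmultiples (D : ℚ) →
          rowHom C i m = D * z := by
        intro i
        by_cases h : rowHom C i m ∈ AddSubgroup.zmultiples (D : ℚ)
        · obtain ⟨z, hz⟩ := AddSubgroup.mem_zmultiples_iff.1 h
          exact ⟨z, fun _ => by rw [← hz]; simp [mul_comm]⟩
        · exact ⟨0, fun h' => absurd h' h⟩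
      choose z hz using hz
      set w : n → ℤ := fun i =>
        if rowHom C i m ∈ AddSubgroup.zmultiples (D : ℚ) then z i else 0 with hw
      have hm' : m - E.mulVecLin w ≠ 0 := by
        intro h
        exact hm ⟨w, (sub_eq_zero.1 h).symm⟩
      obtain ⟨i, t, ht0, ht⟩ := hC _ hm'
      have ht' : rowHom C i m - D * w i = t := by
        rw [← hrow, ← map_sub]; exact ht
      have hni : rowHom C i m ∉ AddSubgroup.zmultiples (D : ℚ) := by
        intro h
        rw [hz i h] at ht'
        simp only [hw, h, if_true, sub_self] at ht'
        exact ht0 (by exact_mod_cast ht'.symm)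
      have hti : rowHom C i m = t := by
        simpa [hw, hni] using ht'
      by_contra hcon
      push Not at hcon
      have hall : ∀ k ≤ l.length, rowHom C i m ∈ AddSubgroup.zmultiples (c k : ℚ) := by
        intro k
        induction k with
        | zero =>
          intro _
          exact AddSubgroup.mem_zmultiples_iff.2 ⟨t, by simp [hcdef, hti]⟩
        | succ k ih =>
          intro hk
          exact hcon (i, ⟨k, hk⟩) (Finset.mem_univ _) (ih (by omega))
      have := hall _ le_rfl
      simp only [hcdef, List.take_length, hlprod] at this
      exact hni this)
    (by
      rw [indexLength, AddSubgroup.relIndex_top_right, hidx,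
        ArithmeticFunction.cardFactors_pow, ArithmeticFunction.cardFactors_apply])
  refine ⟨i, fun j => ?_⟩
  have hmem : (Pi.single j 1 : n → ℤ) ∈
      (AddSubgroup.zmultiples (c k : ℚ)).comap (rowHom C i) := by
    rw [hik]; trivial
  obtain ⟨z, hz⟩ := AddSubgroup.mem_zmultiples_iff.1 hmem
  refine ⟨z * c k, ?_⟩
  have h1 : rowHom C i (Pi.single j 1) = C i j := by
    simp [rowHom, Pi.single_apply]
  rw [← h1, ← hz]
  simp

end Rational

/-! ### Hajós' theorem for real matrices -/

section RealMatrix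

theorem exists_rat_retraction {ι : Type*} [Finite ι] (s : ι → ℝ)
    (hs : ∀ i, ∀ z : ℤ, s i ≠ z) :
    ∃ φ : ℝ →ₗ[ℚ] ℚ, φ 1 = 1 ∧ ∀ i, ∀ z : ℤ, φ (s i) ≠ z := by
  obtain ⟨φ₁, h₁⟩ := Module.exists_dual_forall_apply_ne_zero (K := ℚ) (fun _ : Unit => (1 : ℝ))
    (by simp)
  set φ₀ : ℝ →ₗ[ℚ] ℚ := (φ₁ 1)⁻¹ • φ₁ with hφ₀
  have h₀ : φ₀ 1 = 1 := by simp [hφ₀, h₁ ()]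
  set R : Submodule ℚ ℝ := Submodule.span ℚ {1}
  obtain ⟨ψ₁, hψ₁⟩ := Module.exists_dual_forall_apply_ne_zero (K := ℚ)
    (fun i : {i // s i ∉ R} => R.mkQ (s i)) (fun i => by simpa using i.2)
  have hψ1 : ψ₁ (R.mkQ 1) = 0 := by
    have : R.mkQ 1 = 0 :=
      (Submodule.Quotient.mk_eq_zero R).2 (Submodule.mem_span_singleton_self (1 : ℝ))
    rw [this, map_zero]
  have hev : ∀ i : {i // s i ∉ R}, ∀ᶠ p : ℕ in Filter.atTop, ∀ z : ℤ,
      φ₀ (s i) + ψ₁ (R.mkQ (s i)) / p ≠ z := by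
    intro i
    set a := ψ₁ (R.mkQ (s i)) with ha
    set b := φ₀ (s i)
    filter_upwards [Filter.eventually_gt_atTop (a.num * b.den).natAbs] with p hp z hz
    have hp0 : (p : ℚ) ≠ 0 := by
      have : p ≠ 0 := by omega
      exact_mod_cast this
    have hne : a.num * b.den ≠ 0 :=
      mul_ne_zero (Rat.num_ne_zero.2 (hψ₁ i)) (by exact_mod_cast b.den_ne_zero)
    have hdvd : (p : ℤ) ∣ a.num * b.den := by
      refine ⟨(z * b.den - b.num) * a.den, ?_⟩
      have e1 : a * a.den = a.num := Rat.mul_den_eq_num a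
      have e2 : b * b.den = b.num := Rat.mul_den_eq_num b
      have e3 : a = (z - b) * p := by
        rw [← hz]; field_simp; ring
      have : ((a.num * b.den : ℤ) : ℚ) = ((p * ((z * b.den - b.num) * a.den) : ℤ) : ℚ) := by
        push_cast
        rw [← e1, ← e2]
        nth_rewrite 1 [e3]
        ring
      exact_mod_cast this
    have := Nat.le_of_dvd (Int.natAbs_pos.2 hne) (Int.natCast_dvd.1 hdvd)
    omega
  obtain ⟨p, hp⟩ := (Filter.eventually_all.2 hev).exists
  refine ⟨φ₀ + (p : ℚ)⁻¹ • (ψ₁ ∘ₗ R.mkQ), ?_, fun i z hz => ?_⟩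
  · simp only [LinearMap.add_apply, LinearMap.smul_apply, LinearMap.comp_apply, hψ1, h₀]
    simp
  by_cases hi : s i ∈ R
  · obtain ⟨r, hr⟩ := Submodule.mem_span_singleton.1 hi
    rw [← hr, map_smul] at hz
    simp only [LinearMap.add_apply, LinearMap.smul_apply, LinearMap.comp_apply, hψ1, h₀] at hz
    refine hs i z ?_
    have hz' : r = z := by simpa using hz
    rw [← hr, hz']
    simp [Algebra.smul_def]
  · refine hp ⟨i, hi⟩ z ?_
    rw [← hz]
    simp only [LinearMap.add_apply, LinearMap.smul_apply, LinearMap.comp_apply, smul_eq_mul]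
    ring

variable {n : Type*} [Fintype n]

/-- For every nonzero integer vector `m`, some coordinate of `C m` is a nonzero integer. -/
def HasIntegerCoordinate (C : Matrix n n ℝ) : Prop :=
  ∀ m : n → ℤ, m ≠ 0 → ∃ i, ∃ z : ℤ, z ≠ 0 ∧ ∑ j, C i j * m j = z

variable [DecidableEq n]

theorem HasIntegerCoordinate.det_ne_zero {C : Matrix n n ℝ} (hC : HasIntegerCoordinate C) :
    C.det ≠ 0 := by
  have hsum : ∀ (m : n → ℤ) i, (∑ j, m j • C.col j) i = ∑ j, C i j * m j := by
    intro m i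
    simp [Finset.sum_apply, Matrix.col, mul_comm]
  have hli : LinearIndependent ℤ C.col := by
    rw [Fintype.linearIndependent_iff]
    intro m hm
    by_contra! hcon
    obtain ⟨j, hj⟩ := hcon
    obtain ⟨i, z, hz, h⟩ := hC m fun h => hj (by simp [h])
    rw [← hsum, hm] at h
    exact hz (by simpa using h.symm)
  have hdisc : DiscreteTopology (Submodule.span ℤ (Set.range C.col)) := by
    refine DiscreteTopology.of_forall_le_norm (r := 1) one_pos fun x hx => ?_
    obtain ⟨m, hm⟩ := (Submodule.mem_span_range_iff_exists_fun ℤ).1 x.2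
    have hm0 : m ≠ 0 := by
      rintro rfl
      exact hx (Subtype.ext (by rw [← hm]; simp))
    obtain ⟨i, z, hz, h⟩ := hC m hm0
    rw [← hsum, hm] at h
    refine le_trans ?_ (norm_le_pi_norm (x : n → ℝ) i)
    rw [h, Real.norm_eq_abs]
    exact_mod_cast Int.one_le_abs hz
  have hfin := Real.finrank_eq_int_finrank_of_discrete hdisc
  have hZ : Set.finrank ℤ (Set.range C.col) = Fintype.card n := finrank_span_eq_card hli
  have hR : LinearIndependent ℝ C.col :=
    linearIndependent_iff_card_eq_finrank_span.2 (by rw [hfin, hZ])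
  exact ((Matrix.isUnit_iff_isUnit_det C).1
    (Matrix.linearIndependent_cols_iff_isUnit.1 hR)).ne_zero

theorem HasIntegerCoordinate.updateRow {C : Matrix n n ℝ} (hC : HasIntegerCoordinate C) (i : n)
    {φ : ℝ →ₗ[ℚ] ℚ} (hφ : φ 1 = 1) (t : ℝ) :
    HasIntegerCoordinate (C.updateRow i ((1 - t) • C i + t • fun j => (φ (C i j) : ℝ))) := by
  intro m hm
  obtain ⟨k, z, hz, h⟩ := hC m hm
  refine ⟨k, z, hz, ?_⟩
  by_cases hk : k = i
  · subst hk
    have h1 : ∑ j, (φ (C k j) : ℝ) * m j = z := by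
      have h2 := congrArg φ h
      have h3 : ∀ (x : ℝ) (a : ℤ), φ (x * a) = φ x * a := by
        intro x a
        have : x * a = a • x := by simp [mul_comm]
        rw [this, map_zsmul]; simp [mul_comm]
      have h4 : φ (z : ℝ) = z := by
        have := h3 1 z
        rwa [one_mul, hφ, one_mul] at this
      rw [map_sum, h4] at h2
      simp only [h3] at h2
      exact_mod_cast congrArg (fun x : ℚ => (x : ℝ)) h2
    simp only [Matrix.updateRow_self, Pi.add_apply, Pi.smul_apply, smul_eq_mul, add_mul,
      Finset.sum_add_distrib, mul_assoc, ← Finset.mul_sum, h, h1]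
    ring
  · simpa [Matrix.updateRow_ne hk] using h

theorem HasIntegerCoordinate.det_updateRow {C : Matrix n n ℝ} (hC : HasIntegerCoordinate C)
    (i : n) {φ : ℝ →ₗ[ℚ] ℚ} (hφ : φ 1 = 1) :
    (C.updateRow i fun j => (φ (C i j) : ℝ)).det = C.det := by
  set C' := C.updateRow i fun j => (φ (C i j) : ℝ) with hC'
  by_contra hne
  have hd : C.det - C'.det ≠ 0 := sub_ne_zero.2 (Ne.symm hne)
  refine (hC.updateRow i hφ (C.det / (C.det - C'.det))).det_ne_zero ?_
  rw [Matrix.det_updateRow_add, Matrix.det_updateRow_smul, Matrix.det_updateRow_smul, ← hC',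
    Matrix.updateRow_eq_self]
  field_simp
  ring

theorem HasIntegerCoordinate.map_rat {C : Matrix n n ℝ} (hC : HasIntegerCoordinate C)
    {φ : ℝ →ₗ[ℚ] ℚ} (hφ : φ 1 = 1) :
    HasIntegerCoordinate (C.map fun x => (φ x : ℝ)) ∧
      (C.map fun x => (φ x : ℝ)).det = C.det := by
  suffices h : ∀ S : Finset n,
      HasIntegerCoordinate (Matrix.of fun i j => if i ∈ S then (φ (C i j) : ℝ) else C i j) ∧
      (Matrix.of fun i j => if i ∈ S then (φ (C i j) : ℝ) else C i j).det = C.det by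
    simpa using! h Finset.univ
  intro S
  induction S using Finset.induction_on with
  | empty => exact ⟨by simpa using! hC, by simp; rfl⟩
  | insert i S hi ih =>
    obtain ⟨ih1, ih2⟩ := ih
    set M : Matrix n n ℝ := Matrix.of fun i j => if i ∈ S then (φ (C i j) : ℝ) else C i j
    have hM : (Matrix.of fun k j => if k ∈ insert i S then (φ (C k j) : ℝ) else C k j) =
        M.updateRow i fun j => (φ (M i j) : ℝ) := by
      ext k j
      by_cases hk : k = i
      · subst hk; simp [M, hi]
      · simp [M, hk]
    rw [hM]
    refine ⟨?_, (ih1.det_updateRow i hφ).trans ih2⟩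
    simpa using ih1.updateRow i hφ 1

theorem HasIntegerCoordinate.exists_integral_row [Nonempty n] {C : Matrix n n ℝ}
    (hC : HasIntegerCoordinate C) (hdet : C.det = 1 ∨ C.det = -1) :
    ∃ i, ∀ j, ∃ z : ℤ, C i j = z := by
  obtain ⟨φ, hφ, hφs⟩ := exists_rat_retraction
    (fun p : {p : n × n // ∀ z : ℤ, C p.1 p.2 ≠ z} => C p.1.1 p.1.2) (fun p => p.2)
  obtain ⟨hP, hD⟩ := hC.map_rat hφ
  have hD' : ((C.map φ).det : ℝ) = C.det := by
    rw [← hD]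
    exact (Rat.castHom ℝ).map_det (C.map φ)
  obtain ⟨i, hi⟩ := exists_integral_row_rat (C.map φ)
    (by rcases hdet with h | h
        · left; rw [h] at hD'; exact_mod_cast hD'
        · right; rw [h] at hD'; exact_mod_cast hD')
    (fun m hm => by
      obtain ⟨i, z, hz, h⟩ := hP m hm
      exact ⟨i, z, hz, by simp only [Matrix.map_apply] at h ⊢; exact_mod_cast h⟩)
  refine ⟨i, fun j => ?_⟩
  by_contra! hcon
  obtain ⟨z, hz⟩ := hi j
  exact hφs ⟨(i, j), hcon⟩ z hz

end RealMatrix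

/-! ### Lattice tilings by unit cubes -/

section CubeTiling

open MeasureTheory Complex
open scoped Pointwise

variable {ι : Type*} [Fintype ι]

/-- The lattice spanned by a basis, as an additive subgroup. -/
abbrev latticeOf (b : Module.Basis ι ℝ (ι → ℝ)) : AddSubgroup (ι → ℝ) :=
  (Submodule.span ℤ (Set.range b)).toAddSubgroup

instance (b : Module.Basis ι ℝ (ι → ℝ)) : Countable (latticeOf b) :=
  inferInstanceAs (Countable (Submodule.span ℤ (Set.range b)))

theorem isAddFundamentalDomain_Icc {b : Module.Basis ι ℝ (ι → ℝ)}
    (hcover : ∀ x, ∃ l ∈ latticeOf b, l + x ∈ Set.Icc (0 : ι → ℝ) 1)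
    (hdisj : ∀ l ∈ latticeOf b, l ≠ 0 →
      ∀ x ∈ Set.pi Set.univ fun _ : ι => Set.Ioo (0 : ℝ) 1,
        l + x ∉ Set.pi Set.univ fun _ : ι => Set.Ioo (0 : ℝ) 1) :
    IsAddFundamentalDomain (latticeOf b) (Set.Icc (0 : ι → ℝ) 1) volume := by
  refine IsAddFundamentalDomain.mk'' measurableSet_Icc.nullMeasurableSet
    (ae_of_all _ fun x => ?_) (fun l hl => ?_) fun l =>
      (measurePreserving_vadd l volume).quasiMeasurePreserving
  · obtain ⟨l, hl, h⟩ := hcover x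
    exact ⟨⟨l, hl⟩, h⟩
  · have hae : (Set.pi Set.univ fun _ : ι => Set.Ioo (0 : ℝ) 1) =ᵐ[volume]
        Set.Icc (0 : ι → ℝ) 1 := Measure.univ_pi_Ioo_ae_eq_Icc
    have hae' : (l +ᵥ (Set.pi Set.univ fun _ : ι => Set.Ioo (0 : ℝ) 1) : Set (ι → ℝ)) =ᵐ[volume]
        (l +ᵥ Set.Icc (0 : ι → ℝ) 1 : Set (ι → ℝ)) := by
      rw [← Set.preimage_vadd_neg, ← Set.preimage_vadd_neg]
      exact (measurePreserving_vadd (-l) volume).quasiMeasurePreserving.preimage_ae_eq hae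
    refine AEDisjoint.congr (Disjoint.aedisjoint ?_) hae'.symm hae.symm
    rw [Set.disjoint_left]
    rintro _ ⟨x, hx, rfl⟩
    exact hdisj l l.2 (fun h => hl (Subtype.ext h)) x hx

theorem exists_int_of_integral_exp_eq_zero {f : ℝ}
    (h : ∫ t in Set.Icc (0 : ℝ) 1, exp (2 * Real.pi * I * f * t) = 0) :
    ∃ z : ℤ, z ≠ 0 ∧ f = z := by
  rw [integral_Icc_eq_integral_Ioc, ← intervalIntegral.integral_of_le zero_le_one] at h
  have hf : f ≠ 0 := by
    rintro rfl
    simp at h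
  have hc : (2 * Real.pi * I * f : ℂ) ≠ 0 := by
    simp [Real.pi_ne_zero, hf]
  rw [integral_exp_mul_complex hc, div_eq_zero_iff, or_iff_left hc] at h
  have h1 : exp (2 * Real.pi * I * f) = 1 := by
    simpa [sub_eq_zero] using h
  obtain ⟨z, hz⟩ := exp_eq_one_iff.1 h1
  have hfz : f = z := by
    have h2 : (2 * Real.pi * I : ℂ) ≠ 0 := by simp [Real.pi_ne_zero]
    have h3 : (f : ℂ) = z := mul_left_cancel₀ h2 (by rw [hz]; ring)
    exact_mod_cast h3
  exact ⟨z, by rintro rfl; simp [hfz] at hf, hfz⟩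

theorem exists_int_of_integral_cube_eq_zero {f : ι → ℝ}
    (h : ∫ x in Set.Icc (0 : ι → ℝ) 1, exp (2 * Real.pi * I * (∑ i, f i * x i : ℝ)) = 0) :
    ∃ i, ∃ z : ℤ, z ≠ 0 ∧ f i = z := by
  have h1 : ∫ x in Set.Icc (0 : ι → ℝ) 1, exp (2 * Real.pi * I * (∑ i, f i * x i : ℝ)) =
      ∏ i, ∫ t in Set.Icc (0 : ℝ) 1, exp (2 * Real.pi * I * f i * t) := by
    rw [← integral_fintype_prod_eq_prod (fun i (t : ℝ) => exp (2 * Real.pi * I * f i * t)),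
      ← Set.pi_univ_Icc, volume_pi, Measure.restrict_pi_pi]
    refine integral_congr_ae (ae_of_all _ fun x => ?_)
    simp only
    rw [← exp_sum]
    push_cast
    rw [Finset.mul_sum]
    simp only [mul_assoc]
  rw [h1, Finset.prod_eq_zero_iff] at h
  obtain ⟨i, -, hi⟩ := h
  exact ⟨i, exists_int_of_integral_exp_eq_zero hi⟩

theorem integral_exp_eq_zero_of_isAddFundamentalDomain {b : Module.Basis ι ℝ (ι → ℝ)}
    {s : Set (ι → ℝ)} (hs : IsAddFundamentalDomain (latticeOf b) s volume)
    (f : (ι → ℝ) →ₗ[ℝ] ℝ) (hf : ∀ l ∈ latticeOf b, ∃ z : ℤ, f l = z) (hf0 : f ≠ 0) :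
    ∫ x in s, exp (2 * Real.pi * I * (f x : ℝ)) = 0 := by
  obtain ⟨v, hv⟩ : ∃ v, f v = 1 / 2 := LinearMap.surjective hf0 _
  have hvs := hs.vadd_of_comm v
  have heq := hs.setIntegral_eq hvs (f := fun x => exp (2 * Real.pi * I * (f x : ℝ)))
    (fun l x => by
      obtain ⟨z, hz⟩ := hf l l.2
      have : f (l +ᵥ x) = z + f x := by rw [← hz, ← map_add]; rfl
      rw [this]
      refine exp_eq_exp_iff_exists_int.2 ⟨z, ?_⟩
      push_cast
      ring)
  have hsh : ∫ x in v +ᵥ s, exp (2 * Real.pi * I * (f x : ℝ)) =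
      ∫ x in s, exp (2 * Real.pi * I * (f (v + x) : ℝ)) :=
    (measurePreserving_vadd v volume).setIntegral_image_emb
      (measurableEmbedding_const_vadd v) _ _
  have hneg : ∀ x, exp (2 * Real.pi * I * (f (v + x) : ℝ)) =
      -exp (2 * Real.pi * I * (f x : ℝ)) := by
    intro x
    have : (2 * Real.pi * I * (f (v + x) : ℝ) : ℂ) =
        Real.pi * I + 2 * Real.pi * I * (f x : ℝ) := by
      rw [map_add, hv]; push_cast; ring
    rw [this, exp_add, exp_pi_mul_I, neg_one_mul]
  rw [hsh] at heq
  simp only [hneg, integral_neg] at heq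
  exact self_eq_neg.1 heq

theorem exists_single_mem_latticeOf [DecidableEq ι] [Nonempty ι]
    {b : Module.Basis ι ℝ (ι → ℝ)}
    (hs : IsAddFundamentalDomain (latticeOf b) (Set.Icc (0 : ι → ℝ) 1) volume) :
    ∃ i, Pi.single i 1 ∈ latticeOf b := by
  set C : Matrix ι ι ℝ := Matrix.of fun i j => b.repr (Pi.single i 1) j with hC
  have hCB : C * Matrix.of b = 1 := by
    ext i j
    have := congrFun (b.sum_repr (Pi.single i 1)) j
    simpa [Matrix.mul_apply, hC, Finset.sum_apply, Matrix.one_apply, Pi.single_apply, eq_comm]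
      using this
  have hBC := mul_eq_one_comm.1 hCB
  have hvol : |(Matrix.of b).det| = 1 := by
    have h := hs.measure_eq (ZSpan.isAddFundamentalDomain' b volume)
    rw [ZSpan.volume_fundamentalDomain, Real.volume_Icc_pi] at h
    refine ENNReal.ofReal_eq_one.1 ?_
    simpa using h.symm
  have hdet : C.det = 1 ∨ C.det = -1 := by
    have h := congrArg Matrix.det hCB
    rw [Matrix.det_mul, Matrix.det_one] at h
    rcases eq_or_eq_neg_of_abs_eq hvol with h' | h' <;> rw [h'] at h
    · left; linarith
    · right; linarith
  have hP : HasIntegerCoordinate C := by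
    intro m hm
    set f : (ι → ℝ) →ₗ[ℝ] ℝ :=
      ∑ i, (∑ j, C i j * m j) • LinearMap.proj i with hf
    have hfx : ∀ x, f x = ∑ i, (∑ j, C i j * m j) * x i := fun x => by
      simp [hf]
    have hfb : ∀ k, f (b k) = m k := by
      intro k
      have h := congrFun (congrArg (fun A => Matrix.mulVec A (fun j => (m j : ℝ))) hBC) k
      simp only [← Matrix.mulVec_mulVec, Matrix.one_mulVec] at h
      rw [← h, hfx]
      simp [Matrix.mulVec, dotProduct, mul_comm]
    refine exists_int_of_integral_cube_eq_zero ?_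
    simp only [← hfx]
    refine integral_exp_eq_zero_of_isAddFundamentalDomain hs f (fun l hl => ?_) fun h0 => hm ?_
    · change l ∈ Submodule.span ℤ (Set.range b) at hl
      induction hl using Submodule.span_induction with
      | mem x hx =>
        obtain ⟨k, rfl⟩ := hx
        exact ⟨m k, hfb k⟩
      | zero => exact ⟨0, by simp⟩
      | add x y _ _ hx hy =>
        obtain ⟨z, hz⟩ := hx
        obtain ⟨w, hw⟩ := hy
        exact ⟨z + w, by simp [hz, hw]⟩
      | smul a x _ hx =>
        obtain ⟨z, hz⟩ := hx
        exact ⟨a * z, by rw [map_zsmul, hz]; simp⟩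
    · ext k
      have := hfb k
      rw [h0] at this
      simpa using this.symm
  obtain ⟨i, hi⟩ := hP.exists_integral_row hdet
  refine ⟨i, ?_⟩
  change _ ∈ Submodule.span ℤ (Set.range b)
  rw [b.mem_span_iff_repr_mem ℤ]
  intro j
  obtain ⟨z, hz⟩ := hi j
  exact ⟨z, hz.symm⟩

end CubeTiling

/-- Hajós: in a lattice tiling of `ℝ^d` by unit cubes, the lattice
contains a standard basis vector. -/
theorem hajos_minkowski (d : ℕ) (hd : 1 ≤ d) (b : Fin d → Euc d)
    (hb : LinearIndependent ℝ b) (L : Submodule ℤ (Euc d))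
    (hL : L = Submodule.span ℤ (Set.range b))
    (hcover : (⋃ l ∈ (L : Set (Euc d)), (l + ·) '' unitCube d) = Set.univ)
    (hdisj : ∀ l₁ ∈ L, ∀ l₂ ∈ L, l₁ ≠ l₂ →
      interior ((l₁ + ·) '' unitCube d) ∩ interior ((l₂ + ·) '' unitCube d) = ∅) :
    ∃ i : Fin d, EuclideanSpace.single i (1 : ℝ) ∈ L := by
  have : Nonempty (Fin d) := ⟨⟨0, hd⟩⟩
  let e : Euc d ≃ₗ[ℝ] (Fin d → ℝ) := WithLp.linearEquiv 2 ℝ (Fin d → ℝ)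
  let bE : Module.Basis (Fin d) ℝ (Euc d) :=
    basisOfLinearIndependentOfCardEqFinrank hb (by simp)
  let b' : Module.Basis (Fin d) ℝ (Fin d → ℝ) := bE.map e
  have hmem : ∀ x : Euc d, x ∈ L ↔ e x ∈ latticeOf b' := by
    intro x
    have h1 : L = Submodule.span ℤ (Set.range bE) := by
      rw [hL, coe_basisOfLinearIndependentOfCardEqFinrank]
    change _ ↔ e x ∈ Submodule.span ℤ (Set.range b')
    rw [h1, bE.mem_span_iff_repr_mem ℤ, b'.mem_span_iff_repr_mem ℤ]
    simp [b']
  have hopen : ∀ l : Euc d, ∀ x : Euc d, (∀ i, x i - l i ∈ Set.Ioo (0 : ℝ) 1) →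
      x ∈ interior ((l + ·) '' unitCube d) := by
    intro l x hx
    refine interior_maximal (t := {y : Euc d | ∀ i, y i - l i ∈ Set.Ioo (0 : ℝ) 1}) ?_ ?_ hx
    · intro y hy
      exact ⟨y - l, fun i => Set.Ioo_subset_Icc_self (hy i), by simp⟩
    · simp only [Set.ofPred_forall]
      exact isOpen_iInter_of_finite fun i => isOpen_Ioo.preimage (by fun_prop)
  obtain ⟨i, hi⟩ := exists_single_mem_latticeOf (b := b') <| isAddFundamentalDomain_Icc
    (fun x => by
      have hx : e.symm x ∈ ⋃ l ∈ (L : Set (Euc d)), (l + ·) '' unitCube d := by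
        rw [hcover]; trivial
      simp only [Set.mem_iUnion] at hx
      obtain ⟨l, hl, y, hy, hyx⟩ := hx
      refine ⟨e (-l), (hmem _).1 (L.neg_mem hl), ?_⟩
      have : e (-l) + x = e y := by
        rw [← e.apply_symm_apply x, ← hyx, ← map_add]
        simp
      rw [this]
      exact ⟨fun i => (hy i).1, fun i => (hy i).2⟩)
    (fun l hl hl0 x hx hlx => by
      have h := hdisj (e.symm l) ((hmem _).2 (by simpa using hl)) 0 L.zero_mem (by simpa using hl0)
      have h1 : e.symm (l + x) ∈ (∅ : Set (Euc d)) := by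
        rw [← h]
        refine ⟨hopen _ _ fun i => ?_, hopen _ _ fun i => ?_⟩
        · simpa [e] using hx i trivial
        · simpa [e] using hlx i trivial
      exact h1)
  exact ⟨i, (hmem _).2 hi⟩
end
end

section
/- (Lagarias–Shor, disproving Keller's conjecture.) There exists a set S ⊆ ℝ^10 such that the translates {s + [0,1]^10 : s ∈ S} of the unit cube form a tiling of ℝ^10 (they cover ℝ^10 and their interiors are pairwise disjoint), and no two distinct cubes of the tiling share a complete 9-dimensional face; that is, there are no distinct s, t ∈ S and index i with |s_i − t_i| = 1 and s_j = t_j for all j ≠ i. -/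
open Set

noncomputable section

/-- The `256` bytes of this number encode a map from `8`-bit words to `8`-bit words: byte `A`
is the half-integral part of the cube whose integral part reduces to the binary digits of `A`. -/
def kellerTable : ℕ :=
  23255788289468434185395254458581811076708025150119195644584373083758649907570499356480759777214884954682106555198181891768740382724816570463236130265448327285418226898608465389039266350114554097293462739100695671552689322931496957461485904664256562833832997694599834517958908508969775599344144343370912247943936102496176542567288199857682960338130602478409542469684722726064375096186868438196196363892662343568989667185988771343080916866424257290846555443186329904157540869213459936916344095235955749796031925154901572573156754970152538850839556131159470822754688545869923425417432168469773455259377530501353870674510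

/-- The map on binary words of length `8` encoded by `kellerTable`. -/
def kellerMap (a : Fin 8 → Bool) (i : Fin 8) : Bool :=
  (kellerTable >>> (8 * Nat.ofBits a)).testBit i

theorem kellerTable_separated : ∀ A < 256, ∀ B < A,
    (A ^^^ B) &&& ((kellerTable >>> (8 * A)) ^^^ (kellerTable >>> (8 * B))) ≠ A ^^^ B := by
  decide +kernel

theorem kellerTable_ne_flip : ∀ A < 256, ∀ i < 8,
    (kellerTable >>> (8 * A)) % 256 ≠ (kellerTable >>> (8 * (A ^^^ 2 ^ i))) % 256 := by
  decide +kernel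

theorem ofBits_injective {n : ℕ} : Function.Injective (Nat.ofBits (n := n)) := by
  intro a b h
  funext i
  simpa using congrArg (fun N : ℕ => N.testBit i) h

theorem exists_kellerMap_eq {a b : Fin 8 → Bool} (hab : a ≠ b) :
    ∃ i, a i ≠ b i ∧ kellerMap a i = kellerMap b i := by
  wlog hlt : Nat.ofBits b < Nat.ofBits a generalizing a b
  · obtain ⟨i, h₁, h₂⟩ := this hab.symm
      (lt_of_le_of_ne (not_lt.mp hlt) fun h => hab (ofBits_injective h))
    exact ⟨i, h₁.symm, h₂.symm⟩
  by_contra! hne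
  refine kellerTable_separated _ (Nat.ofBits_lt_two_pow a) _ hlt (Nat.eq_of_testBit_eq fun i => ?_)
  by_cases hi : i < 8
  · have := hne ⟨i, hi⟩
    simp only [kellerMap] at this
    simp only [Nat.testBit_and, Nat.testBit_xor, Nat.testBit_ofBits_lt _ i hi]
    generalize a ⟨i, hi⟩ = p at *
    generalize b ⟨i, hi⟩ = q at *
    revert this
    cases p <;> cases q <;> simp
  · simp only [Nat.testBit_and, Nat.testBit_xor, Nat.testBit_ofBits_ge _ i (not_lt.mp hi),
      bne_self_eq_false, Bool.false_and]

theorem kellerMap_ne_of_differ_once {a b : Fin 8 → Bool} {i : Fin 8} (hi : a i ≠ b i)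
    (h : ∀ j, j ≠ i → a j = b j) : kellerMap a ≠ kellerMap b := by
  intro heq
  have hb : Nat.ofBits b = Nat.ofBits a ^^^ 2 ^ (i : ℕ) := by
    refine Nat.eq_of_testBit_eq fun j => ?_
    rw [Nat.testBit_xor, Nat.testBit_two_pow]
    by_cases hj : j < 8
    · rw [Nat.testBit_ofBits_lt _ j hj, Nat.testBit_ofBits_lt _ j hj]
      by_cases hji : (i : ℕ) = j
      · obtain rfl : i = ⟨j, hj⟩ := Fin.ext hji
        revert hi
        cases a ⟨j, hj⟩ <;> cases b ⟨j, hj⟩ <;> simp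
      · rw [h ⟨j, hj⟩ fun e => hji (by rw [← e])]
        simp [hji]
    · have hji : (i : ℕ) ≠ j := by omega
      rw [Nat.testBit_ofBits_ge _ j (not_lt.mp hj), Nat.testBit_ofBits_ge _ j (not_lt.mp hj)]
      simp [hji]
  refine kellerTable_ne_flip _ (Nat.ofBits_lt_two_pow a) i i.2 (Nat.eq_of_testBit_eq fun j => ?_)
  rw [← hb, show (256 : ℕ) = 2 ^ 8 from rfl, Nat.testBit_mod_two_pow, Nat.testBit_mod_two_pow]
  by_cases hj : j < 8
  · rw [show Nat.testBit _ j = Nat.testBit _ j from congrFun heq ⟨j, hj⟩]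
  · simp [hj]

/-- A map on binary words that agrees somewhere on the difference of any two words makes every
residue vector modulo `4` uniquely expressible as `2 a + f a + e` with `a`, `e` binary. -/
theorem exists_eq_two_mul_add_add {n : ℕ} {f : (Fin n → Bool) → Fin n → Bool}
    (hf : ∀ a b, a ≠ b → ∃ i, a i ≠ b i ∧ f a i = f b i) (k : Fin n → ℤ) :
    ∃ a e : Fin n → Bool, ∀ i,
      (4 : ℤ) ∣ k i - (2 * (a i).toNat + (f a i).toNat + (e i).toNat) := by
  let F : (Fin n → Bool) × (Fin n → Bool) → Fin n → ZMod 4 := fun p i =>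
    ((2 * (p.1 i).toNat + (f p.1 i).toNat + (p.2 i).toNat : ℤ) : ZMod 4)
  have hF : Function.Injective F := by
    rintro ⟨a, e⟩ ⟨b, e'⟩ h
    have hdvd : ∀ i, (4 : ℤ) ∣ (2 * (b i).toNat + (f b i).toNat + (e' i).toNat) -
        (2 * (a i).toNat + (f a i).toNat + (e i).toNat) := fun i =>
      (ZMod.intCast_eq_intCast_iff_dvd_sub _ _ 4).mp (congrFun h i)
    obtain rfl : a = b := by
      by_contra hab
      obtain ⟨i, hi, hfi⟩ := hf a b hab
      have := hdvd i
      rw [hfi] at this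
      revert this hi
      cases a i <;> cases b i <;> cases e i <;> cases e' i <;> simp <;> omega
    have : e = e' := by
      funext i
      have := hdvd i
      revert this
      cases e i <;> cases e' i <;> simp
    rw [this]
  have hcard : Fintype.card ((Fin n → Bool) × (Fin n → Bool)) =
      Fintype.card (Fin n → ZMod 4) := by
    simp [← mul_pow]
  obtain ⟨⟨a, e⟩, h⟩ :=
    ((Fintype.bijective_iff_injective_and_card F).mpr ⟨hF, hcard⟩).2 fun i => (k i : ZMod 4)
  exact ⟨a, e, fun i => (ZMod.intCast_eq_intCast_iff_dvd_sub _ _ 4).mp (congrFun h i)⟩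

/-- The word of parities of an integer vector. -/
def parityWord {n : ℕ} (u : Fin n → ℤ) (i : Fin n) : Bool := decide (u i % 2 = 1)

/-- The shift, in quarters, of the eight-dimensional layer at heights `w`. -/
def layerShift (w : Fin 2 → ℤ) (i : Fin 8) : ℤ :=
  if ∃ j : Fin 2, i = Fin.castAdd 6 j ∧ w j % 2 = 1 then 1 else 0

theorem layerShift_castAdd (w : Fin 2 → ℤ) (j : Fin 2) :
    layerShift w (Fin.castAdd 6 j) = w j % 2 := by
  have : (∃ l : Fin 2, Fin.castAdd 6 j = Fin.castAdd 6 l ∧ w l % 2 = 1) ↔ w j % 2 = 1 :=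
    ⟨fun ⟨l, hl, hw⟩ => Fin.castAdd_injective 2 6 hl ▸ hw, fun hw => ⟨j, rfl, hw⟩⟩
  rw [layerShift, if_congr this rfl rfl]
  split_ifs <;> omega

/-- Four times the corner of the cube with integral part `(u, w)`. -/
def quarterCorner (u : Fin 8 → ℤ) (w : Fin 2 → ℤ) : Fin 10 → ℤ :=
  Fin.append (m := 8) (n := 2)
    (fun i => 4 * u i + 2 * (kellerMap (parityWord u) i).toNat + layerShift w i)
    (fun j => 4 * w j)

theorem quarterCorner_castAdd (u : Fin 8 → ℤ) (w : Fin 2 → ℤ) (i : Fin 8) :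
    quarterCorner u w (Fin.castAdd 2 i) =
      4 * u i + 2 * (kellerMap (parityWord u) i).toNat + layerShift w i :=
  Fin.append_left _ _ i

theorem quarterCorner_natAdd (u : Fin 8 → ℤ) (w : Fin 2 → ℤ) (j : Fin 2) :
    quarterCorner u w (Fin.natAdd 8 j) = 4 * w j :=
  Fin.append_right _ _ j

theorem exists_four_le_abs_quarterCorner_sub {u u' : Fin 8 → ℤ} {w w' : Fin 2 → ℤ}
    (h : (u, w) ≠ (u', w')) :
    ∃ i, 4 ≤ |quarterCorner u w i - quarterCorner u' w' i| := by
  by_cases hw : w = w'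
  · subst hw
    have hu : u ≠ u' := fun e => h (by rw [e])
    obtain ⟨i, hi, hfi⟩ : ∃ i, u i ≠ u' i ∧
        kellerMap (parityWord u) i = kellerMap (parityWord u') i := by
      by_cases hp : parityWord u = parityWord u'
      · obtain ⟨i, hi⟩ := Function.ne_iff.mp hu
        exact ⟨i, hi, by rw [hp]⟩
      · obtain ⟨i, hi, hfi⟩ := exists_kellerMap_eq hp
        exact ⟨i, fun e => hi (by simp [parityWord, e]), hfi⟩
    refine ⟨Fin.castAdd 2 i, ?_⟩
    rw [quarterCorner_castAdd, quarterCorner_castAdd, hfi, le_abs']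
    omega
  · obtain ⟨j, hj⟩ := Function.ne_iff.mp hw
    refine ⟨Fin.natAdd 8 j, ?_⟩
    rw [quarterCorner_natAdd, quarterCorner_natAdd, le_abs']
    omega

theorem not_facet_sharing_quarterCorner (u u' : Fin 8 → ℤ) (w w' : Fin 2 → ℤ) :
    ¬ ∃ i, |quarterCorner u w i - quarterCorner u' w' i| = 4 ∧
      ∀ j, j ≠ i → quarterCorner u w j = quarterCorner u' w' j := by
  rintro ⟨i, hi, h⟩
  have key : ∀ j, (4 : ℤ) ∣ quarterCorner u w j - quarterCorner u' w' j := by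
    intro j
    by_cases hj : j = i
    · rw [hj, ← dvd_abs, hi]
    · rw [h j hj, sub_self]
      exact dvd_zero 4
  have hw : ∀ j, w j % 2 = w' j % 2 := by
    intro j
    have := key (Fin.castAdd 2 (Fin.castAdd 6 j))
    rw [quarterCorner_castAdd, quarterCorner_castAdd, layerShift_castAdd,
      layerShift_castAdd] at this
    omega
  have hs : layerShift w = layerShift w' := by
    funext i
    simp only [layerShift, hw]
  have hf : kellerMap (parityWord u) = kellerMap (parityWord u') := by
    funext j
    have := key (Fin.castAdd 2 j)
    rw [quarterCorner_castAdd, quarterCorner_castAdd, hs] at this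
    revert this
    cases kellerMap (parityWord u) j <;> cases kellerMap (parityWord u') j <;> simp <;> omega
  induction i using Fin.addCases (m := 8) (n := 2) with
  | left i =>
    refine kellerMap_ne_of_differ_once (i := i) ?_ (fun j hj => ?_) hf
    · rw [quarterCorner_castAdd, quarterCorner_castAdd, hs, hf] at hi
      simp only [parityWord, ne_eq, decide_eq_decide]
      rcases eq_or_eq_neg_of_abs_eq hi with h' | h' <;> omega
    · have := h (Fin.castAdd 2 j) fun e => hj (Fin.castAdd_injective 8 2 e)
      rw [quarterCorner_castAdd, quarterCorner_castAdd, hs, hf] at this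
      rw [parityWord, parityWord, show u j = u' j by omega]
  | right i =>
    have := hw i
    rw [quarterCorner_natAdd, quarterCorner_natAdd] at hi
    rcases eq_or_eq_neg_of_abs_eq hi with h' | h' <;> omega

theorem exists_quarterCorner_le (m : Fin 10 → ℤ) :
    ∃ u w, ∀ i, quarterCorner u w i ≤ m i ∧ m i ≤ quarterCorner u w i + 3 := by
  let w : Fin 2 → ℤ := fun j => m (Fin.natAdd 8 j) / 4
  let k : Fin 8 → ℤ := fun i => (m (Fin.castAdd 2 i) - layerShift w i) / 2
  obtain ⟨a, e, h⟩ := exists_eq_two_mul_add_add (fun _ _ => exists_kellerMap_eq) k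
  let u : Fin 8 → ℤ := fun i => (k i - (kellerMap a i).toNat - (e i).toNat) / 2
  have hu : parityWord u = a := by
    funext i
    have := h i
    simp only [parityWord, u]
    revert this
    cases a i <;> simp <;> omega
  refine ⟨u, w, fun i => ?_⟩
  induction i using Fin.addCases (m := 8) (n := 2) with
  | left i =>
    rw [quarterCorner_castAdd, hu]
    have hi := h i
    have he := Bool.toNat_le (e i)
    simp only [u]
    have hk : k i = (m (Fin.castAdd 2 i) - layerShift w i) / 2 := rfl
    omega
  | right i =>
    rw [quarterCorner_natAdd]
    simp only [w]
    omega

/-- The corner of the cube with integral part `(u, w)`. -/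
def kellerCorner (p : (Fin 8 → ℤ) × (Fin 2 → ℤ)) : Euc 10 :=
  WithLp.toLp 2 fun i => (quarterCorner p.1 p.2 i : ℝ) / 4

theorem kellerCorner_sub (p q : (Fin 8 → ℤ) × (Fin 2 → ℤ)) (i : Fin 10) :
    kellerCorner p i - kellerCorner q i =
      ((quarterCorner p.1 p.2 i - quarterCorner q.1 q.2 i : ℤ) : ℝ) / 4 := by
  simp [kellerCorner, sub_div]

theorem mem_add_unitCube {d : ℕ} {s y : Euc d} :
    y ∈ (s + ·) '' unitCube d ↔ ∀ i, s i ≤ y i ∧ y i ≤ s i + 1 := by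
  rw [Set.image_add_left, Set.mem_preimage]
  simp only [unitCube, Set.mem_ofPred_eq, Set.mem_Icc, PiLp.add_apply, PiLp.neg_apply]
  refine forall_congr' fun i => and_congr ?_ ?_ <;> constructor <;> intro h <;> linarith

theorem lt_of_mem_interior_add_unitCube {d : ℕ} {s y : Euc d}
    (hy : y ∈ interior ((s + ·) '' unitCube d)) (i : Fin d) : s i < y i ∧ y i < s i + 1 := by
  have hopen : IsOpenMap (EuclideanSpace.proj i : Euc d →L[ℝ] ℝ) :=
    ContinuousLinearMap.isOpenMap _ fun r => ⟨EuclideanSpace.single i r, by simp⟩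
  have hsub : (EuclideanSpace.proj i : Euc d →L[ℝ] ℝ) '' ((s + ·) '' unitCube d) ⊆
      Set.Icc (s i) (s i + 1) := by
    rintro _ ⟨z, hz, rfl⟩
    exact mem_add_unitCube.mp hz i
  have := interior_mono hsub (hopen.image_interior_subset _ ⟨y, hy, rfl⟩)
  rwa [interior_Icc] at this

theorem interior_inter_interior_eq_empty {d : ℕ} {s t : Euc d} {i : Fin d}
    (h : 1 ≤ |s i - t i|) :
    interior ((s + ·) '' unitCube d) ∩ interior ((t + ·) '' unitCube d) = ∅ := by
  refine Set.eq_empty_of_forall_notMem fun y hy => ?_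
  have hs := lt_of_mem_interior_add_unitCube hy.1 i
  have ht := lt_of_mem_interior_add_unitCube hy.2 i
  exact absurd h (not_le.mpr (abs_lt.mpr ⟨by linarith, by linarith⟩))

/-- Lagarias–Shor: there is a tiling of `ℝ^10` by translates of the unit
cube in which no two cubes share a complete 9-dimensional face. -/
theorem lagarias_shor_keller_counterexample :
    ∃ S : Set (Euc 10),
      (⋃ s ∈ S, (s + ·) '' unitCube 10) = Set.univ ∧
      (∀ s ∈ S, ∀ t ∈ S, s ≠ t →
        interior ((s + ·) '' unitCube 10) ∩ interior ((t + ·) '' unitCube 10) = ∅) ∧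
      ¬ ∃ s ∈ S, ∃ t ∈ S, s ≠ t ∧ ∃ i : Fin 10,
          |s i - t i| = 1 ∧ ∀ j, j ≠ i → s j = t j := by
  refine ⟨Set.range kellerCorner, ?_, ?_, ?_⟩
  · refine Set.eq_univ_of_forall fun y => ?_
    obtain ⟨u, w, h⟩ := exists_quarterCorner_le fun i => ⌊4 * y i⌋
    refine Set.mem_biUnion (Set.mem_range_self (u, w)) (mem_add_unitCube.mpr fun i => ?_)
    have hlo : (quarterCorner u w i : ℝ) ≤ ⌊4 * y i⌋ := by exact_mod_cast (h i).1
    have hhi : (⌊4 * y i⌋ : ℝ) ≤ quarterCorner u w i + 3 := by exact_mod_cast (h i).2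
    have hfl := Int.floor_le (4 * y i)
    have hlt := Int.lt_floor_add_one (4 * y i)
    simp only [kellerCorner]
    constructor <;> linarith
  · rintro _ ⟨p, rfl⟩ _ ⟨q, rfl⟩ hpq
    have hne : (p.1, p.2) ≠ (q.1, q.2) := fun e => hpq (congrArg kellerCorner e)
    obtain ⟨i, hi⟩ := exists_four_le_abs_quarterCorner_sub hne
    refine interior_inter_interior_eq_empty (i := i) ?_
    have hi' : (4 : ℝ) ≤ (|quarterCorner p.1 p.2 i - quarterCorner q.1 q.2 i| : ℤ) := by
      exact_mod_cast hi
    rw [kellerCorner_sub, abs_div, ← Int.cast_abs, abs_of_pos (four_pos (α := ℝ))]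
    linarith
  · rintro ⟨_, ⟨p, rfl⟩, _, ⟨q, rfl⟩, -, i, hi, h⟩
    refine not_facet_sharing_quarterCorner p.1 q.1 p.2 q.2 ⟨i, ?_, fun j hj => ?_⟩
    · rw [kellerCorner_sub, abs_div, ← Int.cast_abs, abs_of_pos (four_pos (α := ℝ)),
        div_eq_iff four_ne_zero, one_mul] at hi
      exact_mod_cast hi
    · have := h j hj
      simp only [kellerCorner] at this
      exact_mod_cast (div_left_inj' four_ne_zero).mp this
end
end
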